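/- Let (φ_ε)_{ε∈(0,1]}, (ω_ε)_{ε∈(0,1]} ∈ M_Φ(Ω×ℝ^p) with (φ_ε − ω_ε)_ε negligible in S^1_hg(Ω×ℝ^p∖0). With the same cutoff χ ∈ C_c^∞(ℝ^p) (χ = 1 for |ξ|<1/4, χ = 0 for |ξ|>1/2), form the coefficients a^φ_{j,ε} := i(1−χ)φ_{φ_ε}∂_{ξ_j}φ_ε, b^φ_{k,ε} := i(1−χ)|ξ|^{−2}φ_{φ_ε}∂_{y_k}φ_ε, c^φ_ε := χ + Σ_j ∂_{ξ_j}a^φ_{j,ε} + Σ_k ∂_{y_k}b^φ_{k,ε} (where φ_{φ_ε}(y,ξ) := |∇_{y,ξ}φ_ε(y,ξ/|ξ|)|^{−2}), and the analogous coefficients a^ω_{j,ε}, b^ω_{k,ε}, c^ω_ε for ω_ε. Then for all j = 1,…,p and k = 1,…,n the nets (a^φ_{j,ε} − a^ω_{j,ε})_ε are negligible in S^0(Ω×ℝ^p), and the nets (b^φ_{k,ε} − b^ω_{k,ε})_ε and (c^φ_ε − c^ω_ε)_ε are negligible in S^{−1}(Ω×ℝ^p). -/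

import Mathlib

open MeasureTheory Set
open scoped BigOperators Topology Real

noncomputable section

/-- `Euc d` is `d`-dimensional Euclidean space. -/
abbrev Euc (d : ℕ) : Type := EuclideanSpace ℝ (Fin d)

/-- Directional derivative of `f` in direction `v`. -/
def dirD {E F : Type*} [NormedAddCommGroup E] [NormedSpace ℝ E]
    [NormedAddCommGroup F] [NormedSpace ℝ F] (v : E) (f : E → F) : E → F :=
  fun x => fderiv ℝ f x v

/-- Iterated directional derivatives along a list of directions. -/
def dirDs {E F : Type*} [NormedAddCommGroup E] [NormedSpace ℝ E]
    [NormedAddCommGroup F] [NormedSpace ℝ F] (L : List E) (f : E → F) : E → F :=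
  L.foldr dirD f

/-- ⟨ξ⟩ = (1+|ξ|²)^{1/2}. -/
def jb {d : ℕ} (ξ : Euc d) : ℝ := Real.sqrt (1 + ‖ξ‖ ^ 2)

/-- Basis direction in the first (`y`) block. -/
def eY {n p : ℕ} (k : Fin n) : Euc n × Euc p := (EuclideanSpace.single k 1, 0)

/-- Basis direction in the second (`ξ`) block. -/
def eXi {n p : ℕ} (j : Fin p) : Euc n × Euc p := (0, EuclideanSpace.single j 1)

def eX3 {q n p : ℕ} (i : Fin q) : Euc q × Euc n × Euc p := (EuclideanSpace.single i 1, 0, 0)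
def eY3 {q n p : ℕ} (k : Fin n) : Euc q × Euc n × Euc p := (0, EuclideanSpace.single k 1, 0)
def eXi3 {q n p : ℕ} (j : Fin p) : Euc q × Euc n × Euc p := (0, 0, EuclideanSpace.single j 1)

/-- basis directions of `Euc d` indexed by a list of coordinates -/
def basisL {d : ℕ} (L : List (Fin d)) : List (Euc d) :=
  L.map (fun i => EuclideanSpace.single i 1)

/-- |∇_{y,ξ}φ|² as a sum of squares of partial derivatives. -/
def gradSq {n p : ℕ} (φ : Euc n × Euc p → ℝ) (z : Euc n × Euc p) : ℝ :=
  (∑ k : Fin n, (dirD (eY k) φ z) ^ 2) + ∑ j : Fin p, (dirD (eXi j) φ z) ^ 2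

/-- |∇_ξ φ|². -/
def gradXiSq {n p : ℕ} (φ : Euc n × Euc p → ℝ) (z : Euc n × Euc p) : ℝ :=
  ∑ j : Fin p, (dirD (eXi j) φ z) ^ 2

/-- ∇_y φ as a vector in `Euc n`. -/
def gradY {n p : ℕ} (φ : Euc n × Euc p → ℝ) (z : Euc n × Euc p) : Euc n :=
  (EuclideanSpace.equiv (Fin n) ℝ).symm (fun k => dirD (eY k) φ z)

/-- |∇_{y,ξ}φ|² in the three-block setting (gradient w.r.t. `(y,ξ)` only). -/
def gradSq3 {q n p : ℕ} (φ : Euc q × Euc n × Euc p → ℝ) (z : Euc q × Euc n × Euc p) : ℝ :=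
  (∑ k : Fin n, (dirD (eY3 k) φ z) ^ 2) + ∑ j : Fin p, (dirD (eXi3 j) φ z) ^ 2

/-- slow scale net -/
def SlowScale (s : ℝ → ℝ) : Prop :=
  (∀ ε ∈ Set.Ioc (0:ℝ) 1, 0 < s ε) ∧
  ∀ q : ℕ, ∃ c > 0, ∀ ε ∈ Set.Ioc (0:ℝ) 1, s ε ^ q ≤ c / ε

/-- Moderate net in S^m_{ρ,δ}(Ω×ℝ^p): smoothness, membership, moderate bounds. -/
def SymbModerate {n p : ℕ} (Ω : Set (Euc n)) (m ρ δ : ℝ)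
    (a : ℝ → Euc n × Euc p → ℂ) : Prop :=
  (∀ ε ∈ Set.Ioc (0:ℝ) 1, ContDiffOn ℝ (⊤ : ℕ∞) (a ε) (Ω ×ˢ (univ : Set (Euc p)))) ∧
  (∀ ε ∈ Set.Ioc (0:ℝ) 1, ∀ K ⊆ Ω, IsCompact K → ∀ (α : List (Fin p)) (β : List (Fin n)),
    ∃ C : ℝ, ∀ y ∈ K, ∀ ξ : Euc p,
      jb ξ ^ (-m + ρ * (α.length : ℝ) - δ * (β.length : ℝ)) *
        ‖dirDs (α.map eXi ++ β.map eY) (a ε) (y, ξ)‖ ≤ C) ∧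
  ∀ K ⊆ Ω, IsCompact K → ∀ (α : List (Fin p)) (β : List (Fin n)),
    ∃ N : ℕ, ∃ C > 0, ∃ η ∈ Set.Ioc (0:ℝ) 1, ∀ ε ∈ Set.Ioc (0:ℝ) η, ∀ y ∈ K, ∀ ξ : Euc p,
      jb ξ ^ (-m + ρ * (α.length : ℝ) - δ * (β.length : ℝ)) *
        ‖dirDs (α.map eXi ++ β.map eY) (a ε) (y, ξ)‖ ≤ C * ε ^ (-(N : ℤ))

/-- Negligible net in S^m_{ρ,δ}(Ω×ℝ^p). -/
def SymbNegligible {n p : ℕ} (Ω : Set (Euc n)) (m ρ δ : ℝ)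
    (a : ℝ → Euc n × Euc p → ℂ) : Prop :=
  (∀ ε ∈ Set.Ioc (0:ℝ) 1, ContDiffOn ℝ (⊤ : ℕ∞) (a ε) (Ω ×ˢ (univ : Set (Euc p)))) ∧
  (∀ ε ∈ Set.Ioc (0:ℝ) 1, ∀ K ⊆ Ω, IsCompact K → ∀ (α : List (Fin p)) (β : List (Fin n)),
    ∃ C : ℝ, ∀ y ∈ K, ∀ ξ : Euc p,
      jb ξ ^ (-m + ρ * (α.length : ℝ) - δ * (β.length : ℝ)) *
        ‖dirDs (α.map eXi ++ β.map eY) (a ε) (y, ξ)‖ ≤ C) ∧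
  ∀ K ⊆ Ω, IsCompact K → ∀ (α : List (Fin p)) (β : List (Fin n)), ∀ q : ℕ,
    ∃ C > 0, ∃ η ∈ Set.Ioc (0:ℝ) 1, ∀ ε ∈ Set.Ioc (0:ℝ) η, ∀ y ∈ K, ∀ ξ : Euc p,
      jb ξ ^ (-m + ρ * (α.length : ℝ) - δ * (β.length : ℝ)) *
        ‖dirDs (α.map eXi ++ β.map eY) (a ε) (y, ξ)‖ ≤ C * ε ^ q

/-- Regular net in S^m_{ρ,δ}(Ω×ℝ^p): one N works for all derivatives on each compact set. -/
def SymbRegular {n p : ℕ} (Ω : Set (Euc n)) (m ρ δ : ℝ)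
    (a : ℝ → Euc n × Euc p → ℂ) : Prop :=
  (∀ ε ∈ Set.Ioc (0:ℝ) 1, ContDiffOn ℝ (⊤ : ℕ∞) (a ε) (Ω ×ˢ (univ : Set (Euc p)))) ∧
  (∀ ε ∈ Set.Ioc (0:ℝ) 1, ∀ K ⊆ Ω, IsCompact K → ∀ (α : List (Fin p)) (β : List (Fin n)),
    ∃ C : ℝ, ∀ y ∈ K, ∀ ξ : Euc p,
      jb ξ ^ (-m + ρ * (α.length : ℝ) - δ * (β.length : ℝ)) *
        ‖dirDs (α.map eXi ++ β.map eY) (a ε) (y, ξ)‖ ≤ C) ∧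
  ∀ K ⊆ Ω, IsCompact K → ∃ N : ℕ, ∀ (α : List (Fin p)) (β : List (Fin n)),
    ∃ C > 0, ∃ η ∈ Set.Ioc (0:ℝ) 1, ∀ ε ∈ Set.Ioc (0:ℝ) η, ∀ y ∈ K, ∀ ξ : Euc p,
      jb ξ ^ (-m + ρ * (α.length : ℝ) - δ * (β.length : ℝ)) *
        ‖dirDs (α.map eXi ++ β.map eY) (a ε) (y, ξ)‖ ≤ C * ε ^ (-(N : ℤ))

/-- Moderate net in S^m_hg(Ω×ℝ^p∖0) (F-valued, positively homogeneous symbols). -/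
def HgModerate {n p : ℕ} {F : Type*} [NormedAddCommGroup F] [NormedSpace ℝ F]
    (Ω : Set (Euc n)) (m : ℝ) (φ : ℝ → Euc n × Euc p → F) : Prop :=
  ∀ K ⊆ Ω, IsCompact K → ∀ (α : List (Fin p)) (β : List (Fin n)),
    ∃ N : ℕ, ∃ C > 0, ∃ η ∈ Set.Ioc (0:ℝ) 1, ∀ ε ∈ Set.Ioc (0:ℝ) η, ∀ y ∈ K,
      ∀ ξ : Euc p, ξ ≠ 0 →
      ‖ξ‖ ^ (-m + (α.length : ℝ)) *
        ‖dirDs (α.map eXi ++ β.map eY) (φ ε) (y, ξ)‖ ≤ C * ε ^ (-(N : ℤ))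

/-- Negligible net in S^m_hg(Ω×ℝ^p∖0). -/
def HgNegligible {n p : ℕ} {F : Type*} [NormedAddCommGroup F] [NormedSpace ℝ F]
    (Ω : Set (Euc n)) (m : ℝ) (φ : ℝ → Euc n × Euc p → F) : Prop :=
  ∀ K ⊆ Ω, IsCompact K → ∀ (α : List (Fin p)) (β : List (Fin n)), ∀ q : ℕ,
    ∃ C > 0, ∃ η ∈ Set.Ioc (0:ℝ) 1, ∀ ε ∈ Set.Ioc (0:ℝ) η, ∀ y ∈ K,
      ∀ ξ : Euc p, ξ ≠ 0 →
      ‖ξ‖ ^ (-m + (α.length : ℝ)) *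
        ‖dirDs (α.map eXi ++ β.map eY) (φ ε) (y, ξ)‖ ≤ C * ε ^ q

/-- Net of phase functions on Ω×ℝ^p. -/
def IsPhaseNet {n p : ℕ} (Ω : Set (Euc n)) (φ : ℝ → Euc n × Euc p → ℝ) : Prop :=
  ∀ ε ∈ Set.Ioc (0:ℝ) 1,
    ContDiffOn ℝ (⊤ : ℕ∞) (φ ε) (Ω ×ˢ {ξ : Euc p | ξ ≠ 0}) ∧
    (∀ y ∈ Ω, ∀ ξ : Euc p, ξ ≠ 0 → ∀ t : ℝ, 0 < t → φ ε (y, t • ξ) = t * φ ε (y, ξ)) ∧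
    (∀ y ∈ Ω, ∀ ξ : Euc p, ξ ≠ 0 → gradSq (φ ε) (y, ξ) ≠ 0)

/-- The set M_Φ(Ω×ℝ^p) of moderate nets of phase functions with strictly nonzero gradient. -/
def MPhi {n p : ℕ} (Ω : Set (Euc n)) (φ : ℝ → Euc n × Euc p → ℝ) : Prop :=
  IsPhaseNet Ω φ ∧ HgModerate Ω 1 φ ∧
  ∀ K ⊆ Ω, IsCompact K → ∃ r > (0:ℝ), ∃ η ∈ Set.Ioc (0:ℝ) 1, ∀ ε ∈ Set.Ioc (0:ℝ) η,
    ∀ y ∈ K, ∀ ξ : Euc p, ξ ≠ 0 → ε ^ r ≤ gradSq (φ ε) (y, ‖ξ‖⁻¹ • ξ)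

/-- Slow scale moderateness in S^m_hg. -/
def HgSlowScale {n p : ℕ} {F : Type*} [NormedAddCommGroup F] [NormedSpace ℝ F]
    (Ω : Set (Euc n)) (m : ℝ) (φ : ℝ → Euc n × Euc p → F) : Prop :=
  ∀ K ⊆ Ω, IsCompact K → ∀ (α : List (Fin p)) (β : List (Fin n)),
    ∃ s : ℝ → ℝ, SlowScale s ∧ ∃ η ∈ Set.Ioc (0:ℝ) 1, ∀ ε ∈ Set.Ioc (0:ℝ) η, ∀ y ∈ K,
      ∀ ξ : Euc p, ξ ≠ 0 →
      ‖ξ‖ ^ (-m + (α.length : ℝ)) *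
        ‖dirDs (α.map eXi ++ β.map eY) (φ ε) (y, ξ)‖ ≤ s ε

/-- Slow scale nets of phase functions M_{Φ,sc}(Ω×ℝ^p). -/
def MPhiSc {n p : ℕ} (Ω : Set (Euc n)) (φ : ℝ → Euc n × Euc p → ℝ) : Prop :=
  IsPhaseNet Ω φ ∧ HgSlowScale Ω 1 φ ∧
  ∀ K ⊆ Ω, IsCompact K → ∃ s : ℝ → ℝ, SlowScale s ∧ ∃ η ∈ Set.Ioc (0:ℝ) 1,
    ∀ ε ∈ Set.Ioc (0:ℝ) η, ∀ y ∈ K, ∀ ξ : Euc p, ξ ≠ 0 →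
      (s ε)⁻¹ ≤ gradSq (φ ε) (y, ‖ξ‖⁻¹ • ξ)

/-- cut-off function equal to 1 for |ξ|<1/4 and 0 for |ξ|>1/2. -/
def IsCutoff {p : ℕ} (χ : Euc p → ℝ) : Prop :=
  ContDiff ℝ (⊤ : ℕ∞) χ ∧ (∀ ξ : Euc p, ‖ξ‖ < 1/4 → χ ξ = 1) ∧ (∀ ξ : Euc p, 1/2 < ‖ξ‖ → χ ξ = 0)

/-- 1/|∇_{y,ξ}φ(y,ξ/|ξ|)|². -/
def varphiN {n p : ℕ} (φ : Euc n × Euc p → ℝ) (z : Euc n × Euc p) : ℝ :=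
  (gradSq φ (z.1, ‖z.2‖⁻¹ • z.2))⁻¹

def coefA {n p : ℕ} (χ : Euc p → ℝ) (φ : Euc n × Euc p → ℝ) (j : Fin p) :
    Euc n × Euc p → ℂ :=
  fun z => Complex.I * (((1 - χ z.2) * varphiN φ z * dirD (eXi j) φ z : ℝ) : ℂ)

def coefB {n p : ℕ} (χ : Euc p → ℝ) (φ : Euc n × Euc p → ℝ) (k : Fin n) :
    Euc n × Euc p → ℂ :=
  fun z => Complex.I * (((1 - χ z.2) * (‖z.2‖ ^ 2)⁻¹ * varphiN φ z * dirD (eY k) φ z : ℝ) : ℂ)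

def coefC {n p : ℕ} (χ : Euc p → ℝ) (φ : Euc n × Euc p → ℝ) : Euc n × Euc p → ℂ :=
  fun z => ((χ z.2 : ℝ) : ℂ) + (∑ j : Fin p, dirD (eXi j) (coefA χ φ j) z)
    + ∑ k : Fin n, dirD (eY k) (coefB χ φ k) z

/-- The operator L_φ. -/
def Lop {n p : ℕ} (χ : Euc p → ℝ) (φ : Euc n × Euc p → ℝ) (f : Euc n × Euc p → ℂ) :
    Euc n × Euc p → ℂ :=
  fun z => (∑ j : Fin p, coefA χ φ j z * dirD (eXi j) f z)
    + (∑ k : Fin n, coefB χ φ k z * dirD (eY k) f z) + coefC χ φ z * f z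

/-- Moderate nets of smooth functions E_M(Ω). -/
def EMod {d : ℕ} (Ω : Set (Euc d)) (v : ℝ → Euc d → ℂ) : Prop :=
  (∀ ε ∈ Set.Ioc (0:ℝ) 1, ContDiffOn ℝ (⊤ : ℕ∞) (v ε) Ω) ∧
  ∀ K ⊆ Ω, IsCompact K → ∀ L : List (Fin d),
    ∃ N : ℕ, ∃ C > 0, ∃ η ∈ Set.Ioc (0:ℝ) 1, ∀ ε ∈ Set.Ioc (0:ℝ) η, ∀ x ∈ K,
      ‖dirDs (basisL L) (v ε) x‖ ≤ C * ε ^ (-(N : ℤ))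

/-- Regular nets of smooth functions E^∞_M(Ω). -/
def EModInf {d : ℕ} (Ω : Set (Euc d)) (v : ℝ → Euc d → ℂ) : Prop :=
  (∀ ε ∈ Set.Ioc (0:ℝ) 1, ContDiffOn ℝ (⊤ : ℕ∞) (v ε) Ω) ∧
  ∀ K ⊆ Ω, IsCompact K → ∃ N : ℕ, ∀ L : List (Fin d),
    ∃ C > 0, ∃ η ∈ Set.Ioc (0:ℝ) 1, ∀ ε ∈ Set.Ioc (0:ℝ) η, ∀ x ∈ K,
      ‖dirDs (basisL L) (v ε) x‖ ≤ C * ε ^ (-(N : ℤ))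

/-- Moderate net in S^m_{ρ,δ}(Ω'×Ω×ℝ^p). -/
def Symb3Moderate {q n p : ℕ} (Ω' : Set (Euc q)) (Ω : Set (Euc n)) (m ρ δ : ℝ)
    (a : ℝ → Euc q × Euc n × Euc p → ℂ) : Prop :=
  (∀ ε ∈ Set.Ioc (0:ℝ) 1, ContDiffOn ℝ (⊤ : ℕ∞) (a ε) (Ω' ×ˢ Ω ×ˢ (univ : Set (Euc p)))) ∧
  (∀ ε ∈ Set.Ioc (0:ℝ) 1, ∀ K' ⊆ Ω', IsCompact K' → ∀ K ⊆ Ω, IsCompact K →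
    ∀ (α : List (Fin p)) (βx : List (Fin q)) (βy : List (Fin n)),
    ∃ C : ℝ, ∀ x ∈ K', ∀ y ∈ K, ∀ ξ : Euc p,
      jb ξ ^ (-m + ρ * (α.length : ℝ) - δ * ((βx.length + βy.length : ℕ) : ℝ)) *
        ‖dirDs (α.map eXi3 ++ βx.map eX3 ++ βy.map eY3) (a ε) (x, y, ξ)‖ ≤ C) ∧
  ∀ K' ⊆ Ω', IsCompact K' → ∀ K ⊆ Ω, IsCompact K →
    ∀ (α : List (Fin p)) (βx : List (Fin q)) (βy : List (Fin n)),
    ∃ N : ℕ, ∃ C > 0, ∃ η ∈ Set.Ioc (0:ℝ) 1, ∀ ε ∈ Set.Ioc (0:ℝ) η,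
      ∀ x ∈ K', ∀ y ∈ K, ∀ ξ : Euc p,
      jb ξ ^ (-m + ρ * (α.length : ℝ) - δ * ((βx.length + βy.length : ℕ) : ℝ)) *
        ‖dirDs (α.map eXi3 ++ βx.map eX3 ++ βy.map eY3) (a ε) (x, y, ξ)‖ ≤ C * ε ^ (-(N : ℤ))

/-- Regular net in S^m_{ρ,δ}(Ω'×Ω×ℝ^p). -/
def Symb3Regular {q n p : ℕ} (Ω' : Set (Euc q)) (Ω : Set (Euc n)) (m ρ δ : ℝ)
    (a : ℝ → Euc q × Euc n × Euc p → ℂ) : Prop :=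
  (∀ ε ∈ Set.Ioc (0:ℝ) 1, ContDiffOn ℝ (⊤ : ℕ∞) (a ε) (Ω' ×ˢ Ω ×ˢ (univ : Set (Euc p)))) ∧
  (∀ ε ∈ Set.Ioc (0:ℝ) 1, ∀ K' ⊆ Ω', IsCompact K' → ∀ K ⊆ Ω, IsCompact K →
    ∀ (α : List (Fin p)) (βx : List (Fin q)) (βy : List (Fin n)),
    ∃ C : ℝ, ∀ x ∈ K', ∀ y ∈ K, ∀ ξ : Euc p,
      jb ξ ^ (-m + ρ * (α.length : ℝ) - δ * ((βx.length + βy.length : ℕ) : ℝ)) *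
        ‖dirDs (α.map eXi3 ++ βx.map eX3 ++ βy.map eY3) (a ε) (x, y, ξ)‖ ≤ C) ∧
  ∀ K' ⊆ Ω', IsCompact K' → ∀ K ⊆ Ω, IsCompact K → ∃ N : ℕ,
    ∀ (α : List (Fin p)) (βx : List (Fin q)) (βy : List (Fin n)),
    ∃ C > 0, ∃ η ∈ Set.Ioc (0:ℝ) 1, ∀ ε ∈ Set.Ioc (0:ℝ) η,
      ∀ x ∈ K', ∀ y ∈ K, ∀ ξ : Euc p,
      jb ξ ^ (-m + ρ * (α.length : ℝ) - δ * ((βx.length + βy.length : ℕ) : ℝ)) *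
        ‖dirDs (α.map eXi3 ++ βx.map eX3 ++ βy.map eY3) (a ε) (x, y, ξ)‖ ≤ C * ε ^ (-(N : ℤ))

/-- Moderate net of order −∞ on Ω'×Ω×ℝ^p. -/
def Smoothing3Moderate {q n p : ℕ} (Ω' : Set (Euc q)) (Ω : Set (Euc n))
    (a : ℝ → Euc q × Euc n × Euc p → ℂ) : Prop :=
  (∀ ε ∈ Set.Ioc (0:ℝ) 1, ContDiffOn ℝ (⊤ : ℕ∞) (a ε) (Ω' ×ˢ Ω ×ˢ (univ : Set (Euc p)))) ∧
  (∀ ε ∈ Set.Ioc (0:ℝ) 1, ∀ m : ℝ, ∀ K' ⊆ Ω', IsCompact K' → ∀ K ⊆ Ω, IsCompact K →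
    ∀ (α : List (Fin p)) (βx : List (Fin q)) (βy : List (Fin n)),
    ∃ C : ℝ, ∀ x ∈ K', ∀ y ∈ K, ∀ ξ : Euc p,
      jb ξ ^ (-m + (α.length : ℝ)) *
        ‖dirDs (α.map eXi3 ++ βx.map eX3 ++ βy.map eY3) (a ε) (x, y, ξ)‖ ≤ C) ∧
  ∀ m : ℝ, ∀ K' ⊆ Ω', IsCompact K' → ∀ K ⊆ Ω, IsCompact K →
    ∀ (α : List (Fin p)) (βx : List (Fin q)) (βy : List (Fin n)),
    ∃ N : ℕ, ∃ C > 0, ∃ η ∈ Set.Ioc (0:ℝ) 1, ∀ ε ∈ Set.Ioc (0:ℝ) η,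
      ∀ x ∈ K', ∀ y ∈ K, ∀ ξ : Euc p,
      jb ξ ^ (-m + (α.length : ℝ)) *
        ‖dirDs (α.map eXi3 ++ βx.map eX3 ++ βy.map eY3) (a ε) (x, y, ξ)‖ ≤ C * ε ^ (-(N : ℤ))

/-- Regular net of order −∞ on Ω'×Ω×ℝ^p. -/
def Smoothing3Regular {q n p : ℕ} (Ω' : Set (Euc q)) (Ω : Set (Euc n))
    (a : ℝ → Euc q × Euc n × Euc p → ℂ) : Prop :=
  (∀ ε ∈ Set.Ioc (0:ℝ) 1, ContDiffOn ℝ (⊤ : ℕ∞) (a ε) (Ω' ×ˢ Ω ×ˢ (univ : Set (Euc p)))) ∧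
  (∀ ε ∈ Set.Ioc (0:ℝ) 1, ∀ m : ℝ, ∀ K' ⊆ Ω', IsCompact K' → ∀ K ⊆ Ω, IsCompact K →
    ∀ (α : List (Fin p)) (βx : List (Fin q)) (βy : List (Fin n)),
    ∃ C : ℝ, ∀ x ∈ K', ∀ y ∈ K, ∀ ξ : Euc p,
      jb ξ ^ (-m + (α.length : ℝ)) *
        ‖dirDs (α.map eXi3 ++ βx.map eX3 ++ βy.map eY3) (a ε) (x, y, ξ)‖ ≤ C) ∧
  ∀ K' ⊆ Ω', IsCompact K' → ∀ K ⊆ Ω, IsCompact K → ∃ N : ℕ, ∀ m : ℝ,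
    ∀ (α : List (Fin p)) (βx : List (Fin q)) (βy : List (Fin n)),
    ∃ C > 0, ∃ η ∈ Set.Ioc (0:ℝ) 1, ∀ ε ∈ Set.Ioc (0:ℝ) η,
      ∀ x ∈ K', ∀ y ∈ K, ∀ ξ : Euc p,
      jb ξ ^ (-m + (α.length : ℝ)) *
        ‖dirDs (α.map eXi3 ++ βx.map eX3 ++ βy.map eY3) (a ε) (x, y, ξ)‖ ≤ C * ε ^ (-(N : ℤ))

/-- Nets of phase functions with parameter x ∈ Ω'. -/
def IsPhaseNet3 {q n p : ℕ} (Ω' : Set (Euc q)) (Ω : Set (Euc n))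
    (φ : ℝ → Euc q × Euc n × Euc p → ℝ) : Prop :=
  ∀ ε ∈ Set.Ioc (0:ℝ) 1,
    ContinuousOn (φ ε) (Ω' ×ˢ Ω ×ˢ (univ : Set (Euc p))) ∧
    ContDiffOn ℝ (⊤ : ℕ∞) (φ ε) (Ω' ×ˢ Ω ×ˢ {ξ : Euc p | ξ ≠ 0}) ∧
    (∀ x ∈ Ω', ∀ y ∈ Ω, ∀ ξ : Euc p, ξ ≠ 0 → ∀ t : ℝ, 0 < t →
      φ ε (x, y, t • ξ) = t * φ ε (x, y, ξ)) ∧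
    (∀ x ∈ Ω', ∀ y ∈ Ω, ∀ ξ : Euc p, ξ ≠ 0 → gradSq3 (φ ε) (x, y, ξ) ≠ 0)

/-- S^1_hg-moderateness in all variables for parametrized phase nets. -/
def Hg3Moderate {q n p : ℕ} (Ω' : Set (Euc q)) (Ω : Set (Euc n)) (m : ℝ)
    (φ : ℝ → Euc q × Euc n × Euc p → ℝ) : Prop :=
  ∀ K' ⊆ Ω', IsCompact K' → ∀ K ⊆ Ω, IsCompact K →
    ∀ (α : List (Fin p)) (βx : List (Fin q)) (βy : List (Fin n)),
    ∃ N : ℕ, ∃ C > 0, ∃ η ∈ Set.Ioc (0:ℝ) 1, ∀ ε ∈ Set.Ioc (0:ℝ) η,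
      ∀ x ∈ K', ∀ y ∈ K, ∀ ξ : Euc p, ξ ≠ 0 →
      ‖ξ‖ ^ (-m + (α.length : ℝ)) *
        ‖dirDs (α.map eXi3 ++ βx.map eX3 ++ βy.map eY3) (φ ε) (x, y, ξ)‖ ≤ C * ε ^ (-(N : ℤ))

def Hg3SlowScale {q n p : ℕ} (Ω' : Set (Euc q)) (Ω : Set (Euc n)) (m : ℝ)
    (φ : ℝ → Euc q × Euc n × Euc p → ℝ) : Prop :=
  ∀ K' ⊆ Ω', IsCompact K' → ∀ K ⊆ Ω, IsCompact K →
    ∀ (α : List (Fin p)) (βx : List (Fin q)) (βy : List (Fin n)),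
    ∃ s : ℝ → ℝ, SlowScale s ∧ ∃ η ∈ Set.Ioc (0:ℝ) 1, ∀ ε ∈ Set.Ioc (0:ℝ) η,
      ∀ x ∈ K', ∀ y ∈ K, ∀ ξ : Euc p, ξ ≠ 0 →
      ‖ξ‖ ^ (-m + (α.length : ℝ)) *
        ‖dirDs (α.map eXi3 ++ βx.map eX3 ++ βy.map eY3) (φ ε) (x, y, ξ)‖ ≤ s ε

/-- M_Φ(Ω';Ω×ℝ^p). -/
def MPhi3 {q n p : ℕ} (Ω' : Set (Euc q)) (Ω : Set (Euc n))
    (φ : ℝ → Euc q × Euc n × Euc p → ℝ) : Prop :=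
  IsPhaseNet3 Ω' Ω φ ∧ Hg3Moderate Ω' Ω 1 φ ∧
  ∀ K' ⊆ Ω', IsCompact K' → ∀ K ⊆ Ω, IsCompact K →
    ∃ r > (0:ℝ), ∃ η ∈ Set.Ioc (0:ℝ) 1, ∀ ε ∈ Set.Ioc (0:ℝ) η,
      ∀ x ∈ K', ∀ y ∈ K, ∀ ξ : Euc p, ξ ≠ 0 →
        ε ^ r ≤ gradSq3 (φ ε) (x, y, ‖ξ‖⁻¹ • ξ)

/-- M_{Φ,sc}(Ω';Ω×ℝ^p). -/
def MPhi3Sc {q n p : ℕ} (Ω' : Set (Euc q)) (Ω : Set (Euc n))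
    (φ : ℝ → Euc q × Euc n × Euc p → ℝ) : Prop :=
  IsPhaseNet3 Ω' Ω φ ∧ Hg3SlowScale Ω' Ω 1 φ ∧
  ∀ K' ⊆ Ω', IsCompact K' → ∀ K ⊆ Ω, IsCompact K →
    ∃ s : ℝ → ℝ, SlowScale s ∧ ∃ η ∈ Set.Ioc (0:ℝ) 1, ∀ ε ∈ Set.Ioc (0:ℝ) η,
      ∀ x ∈ K', ∀ y ∈ K, ∀ ξ : Euc p, ξ ≠ 0 →
        (s ε)⁻¹ ≤ gradSq3 (φ ε) (x, y, ‖ξ‖⁻¹ • ξ)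

def varphiN3 {q n p : ℕ} (φ : Euc q × Euc n × Euc p → ℝ) (z : Euc q × Euc n × Euc p) : ℝ :=
  (gradSq3 φ (z.1, z.2.1, ‖z.2.2‖⁻¹ • z.2.2))⁻¹

def coefA3 {q n p : ℕ} (χ : Euc p → ℝ) (φ : Euc q × Euc n × Euc p → ℝ) (j : Fin p) :
    Euc q × Euc n × Euc p → ℂ :=
  fun z => Complex.I * (((1 - χ z.2.2) * varphiN3 φ z * dirD (eXi3 j) φ z : ℝ) : ℂ)

def coefB3 {q n p : ℕ} (χ : Euc p → ℝ) (φ : Euc q × Euc n × Euc p → ℝ) (k : Fin n) :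
    Euc q × Euc n × Euc p → ℂ :=
  fun z => Complex.I * (((1 - χ z.2.2) * (‖z.2.2‖ ^ 2)⁻¹ * varphiN3 φ z * dirD (eY3 k) φ z : ℝ) : ℂ)

def coefC3 {q n p : ℕ} (χ : Euc p → ℝ) (φ : Euc q × Euc n × Euc p → ℝ) :
    Euc q × Euc n × Euc p → ℂ :=
  fun z => ((χ z.2.2 : ℝ) : ℂ) + (∑ j : Fin p, dirD (eXi3 j) (coefA3 χ φ j) z)
    + ∑ k : Fin n, dirD (eY3 k) (coefB3 χ φ k) z

/-- The operator L_φ(x;y,ξ,∂_y,∂_ξ). -/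
def Lop3 {q n p : ℕ} (χ : Euc p → ℝ) (φ : Euc q × Euc n × Euc p → ℝ)
    (f : Euc q × Euc n × Euc p → ℂ) : Euc q × Euc n × Euc p → ℂ :=
  fun z => (∑ j : Fin p, coefA3 χ φ j z * dirD (eXi3 j) f z)
    + (∑ k : Fin n, coefB3 χ φ k z * dirD (eY3 k) f z) + coefC3 χ φ z * f z


/-- Moderate net of order −∞ on Ω×ℝ^p. -/
def SmoothingModerate {n p : ℕ} (Ω : Set (Euc n)) (a : ℝ → Euc n × Euc p → ℂ) : Prop :=
  (∀ ε ∈ Set.Ioc (0:ℝ) 1, ContDiffOn ℝ (⊤ : ℕ∞) (a ε) (Ω ×ˢ (univ : Set (Euc p)))) ∧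
  (∀ ε ∈ Set.Ioc (0:ℝ) 1, ∀ m : ℝ, ∀ K ⊆ Ω, IsCompact K →
    ∀ (α : List (Fin p)) (β : List (Fin n)),
    ∃ C : ℝ, ∀ y ∈ K, ∀ ξ : Euc p,
      jb ξ ^ (-m + (α.length : ℝ)) *
        ‖dirDs (α.map eXi ++ β.map eY) (a ε) (y, ξ)‖ ≤ C) ∧
  ∀ m : ℝ, ∀ K ⊆ Ω, IsCompact K → ∀ (α : List (Fin p)) (β : List (Fin n)),
    ∃ N : ℕ, ∃ C > 0, ∃ η ∈ Set.Ioc (0:ℝ) 1, ∀ ε ∈ Set.Ioc (0:ℝ) η, ∀ y ∈ K, ∀ ξ : Euc p,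
      jb ξ ^ (-m + (α.length : ℝ)) *
        ‖dirDs (α.map eXi ++ β.map eY) (a ε) (y, ξ)‖ ≤ C * ε ^ (-(N : ℤ))

/-- Regular net of order −∞ on Ω×ℝ^p. -/
def SmoothingRegular {n p : ℕ} (Ω : Set (Euc n)) (a : ℝ → Euc n × Euc p → ℂ) : Prop :=
  (∀ ε ∈ Set.Ioc (0:ℝ) 1, ContDiffOn ℝ (⊤ : ℕ∞) (a ε) (Ω ×ˢ (univ : Set (Euc p)))) ∧
  (∀ ε ∈ Set.Ioc (0:ℝ) 1, ∀ m : ℝ, ∀ K ⊆ Ω, IsCompact K →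
    ∀ (α : List (Fin p)) (β : List (Fin n)),
    ∃ C : ℝ, ∀ y ∈ K, ∀ ξ : Euc p,
      jb ξ ^ (-m + (α.length : ℝ)) *
        ‖dirDs (α.map eXi ++ β.map eY) (a ε) (y, ξ)‖ ≤ C) ∧
  ∀ K ⊆ Ω, IsCompact K → ∃ N : ℕ, ∀ m : ℝ, ∀ (α : List (Fin p)) (β : List (Fin n)),
    ∃ C > 0, ∃ η ∈ Set.Ioc (0:ℝ) 1, ∀ ε ∈ Set.Ioc (0:ℝ) η, ∀ y ∈ K, ∀ ξ : Euc p,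
      jb ξ ^ (-m + (α.length : ℝ)) *
        ‖dirDs (α.map eXi ++ β.map eY) (a ε) (y, ξ)‖ ≤ C * ε ^ (-(N : ℤ))

/-- Moderate net in S^m_{ρ,δ}(V) on the conic set V = Ω×(ℝ^p∖0). -/
def ConicModerate {n p : ℕ} (Ω : Set (Euc n)) (m ρ δ : ℝ)
    (a : ℝ → Euc n × Euc p → ℂ) : Prop :=
  (∀ ε ∈ Set.Ioc (0:ℝ) 1, ContDiffOn ℝ (⊤ : ℕ∞) (a ε) (Ω ×ˢ {ξ : Euc p | ξ ≠ 0})) ∧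
  (∀ ε ∈ Set.Ioc (0:ℝ) 1, ∀ K ⊆ Ω ×ˢ {ξ : Euc p | ξ ≠ 0}, IsCompact K →
    ∀ (α : List (Fin p)) (β : List (Fin n)), ∃ C : ℝ, ∀ z ∈ K, ∀ t : ℝ, 1 ≤ t →
      jb (t • z.2) ^ (-m + ρ * (α.length : ℝ) - δ * (β.length : ℝ)) *
        ‖dirDs (α.map eXi ++ β.map eY) (a ε) (z.1, t • z.2)‖ ≤ C) ∧
  ∀ K ⊆ Ω ×ˢ {ξ : Euc p | ξ ≠ 0}, IsCompact K →
    ∀ (α : List (Fin p)) (β : List (Fin n)),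
    ∃ N : ℕ, ∃ C > 0, ∃ η ∈ Set.Ioc (0:ℝ) 1, ∀ ε ∈ Set.Ioc (0:ℝ) η, ∀ z ∈ K, ∀ t : ℝ, 1 ≤ t →
      jb (t • z.2) ^ (-m + ρ * (α.length : ℝ) - δ * (β.length : ℝ)) *
        ‖dirDs (α.map eXi ++ β.map eY) (a ε) (z.1, t • z.2)‖ ≤ C * ε ^ (-(N : ℤ))

/-- Negligible net in S^m_{ρ,δ}(V) on the conic set V = Ω×(ℝ^p∖0). -/
def ConicNegligible {n p : ℕ} (Ω : Set (Euc n)) (m ρ δ : ℝ)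
    (a : ℝ → Euc n × Euc p → ℂ) : Prop :=
  (∀ ε ∈ Set.Ioc (0:ℝ) 1, ContDiffOn ℝ (⊤ : ℕ∞) (a ε) (Ω ×ˢ {ξ : Euc p | ξ ≠ 0})) ∧
  (∀ ε ∈ Set.Ioc (0:ℝ) 1, ∀ K ⊆ Ω ×ˢ {ξ : Euc p | ξ ≠ 0}, IsCompact K →
    ∀ (α : List (Fin p)) (β : List (Fin n)), ∃ C : ℝ, ∀ z ∈ K, ∀ t : ℝ, 1 ≤ t →
      jb (t • z.2) ^ (-m + ρ * (α.length : ℝ) - δ * (β.length : ℝ)) *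
        ‖dirDs (α.map eXi ++ β.map eY) (a ε) (z.1, t • z.2)‖ ≤ C) ∧
  ∀ K ⊆ Ω ×ˢ {ξ : Euc p | ξ ≠ 0}, IsCompact K →
    ∀ (α : List (Fin p)) (β : List (Fin n)), ∀ q : ℕ,
    ∃ C > 0, ∃ η ∈ Set.Ioc (0:ℝ) 1, ∀ ε ∈ Set.Ioc (0:ℝ) η, ∀ z ∈ K, ∀ t : ℝ, 1 ≤ t →
      jb (t • z.2) ^ (-m + ρ * (α.length : ℝ) - δ * (β.length : ℝ)) *
        ‖dirDs (α.map eXi ++ β.map eY) (a ε) (z.1, t • z.2)‖ ≤ C * ε ^ q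

/-- A point (x₀,ξ₀) at which |∇_ξφ|² is invertible on a neighborhood U×Γ. -/
def InvPt {n p : ℕ} (Ω : Set (Euc n)) (φ : ℝ → Euc n × Euc p → ℝ)
    (z : Euc n × Euc p) : Prop :=
  ∃ U : Set (Euc n), IsOpen U ∧ z.1 ∈ U ∧ U ⊆ Ω ∧ IsCompact (closure U) ∧
  ∃ Γ : Set (Euc p), IsOpen Γ ∧ z.2 ∈ Γ ∧ (∀ ξ ∈ Γ, ∀ t : ℝ, 0 < t → t • ξ ∈ Γ) ∧
  ∃ r : ℝ, ∃ η ∈ Set.Ioc (0:ℝ) 1, ∀ ε ∈ Set.Ioc (0:ℝ) η, ∀ y ∈ U, ∀ ξ ∈ Γ,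
    ε ^ r ≤ gradXiSq (φ ε) (y, ξ)

/-- A point (x₀,ξ₀) at which |∇_ξφ|² is slow scale-invertible on a neighborhood U×Γ. -/
def InvPtSc {n p : ℕ} (Ω : Set (Euc n)) (φ : ℝ → Euc n × Euc p → ℝ)
    (z : Euc n × Euc p) : Prop :=
  ∃ U : Set (Euc n), IsOpen U ∧ z.1 ∈ U ∧ U ⊆ Ω ∧ IsCompact (closure U) ∧
  ∃ Γ : Set (Euc p), IsOpen Γ ∧ z.2 ∈ Γ ∧ (∀ ξ ∈ Γ, ∀ t : ℝ, 0 < t → t • ξ ∈ Γ) ∧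
  ∃ s : ℝ → ℝ, SlowScale s ∧ ∃ η ∈ Set.Ioc (0:ℝ) 1, ∀ ε ∈ Set.Ioc (0:ℝ) η, ∀ y ∈ U, ∀ ξ ∈ Γ,
    (s ε)⁻¹ ≤ gradXiSq (φ ε) (y, ξ)

/-- The set C_φ. -/
def Cphi {n p : ℕ} (Ω : Set (Euc n)) (φ : ℝ → Euc n × Euc p → ℝ) : Set (Euc n × Euc p) :=
  {z | z.1 ∈ Ω ∧ z.2 ≠ 0 ∧ ¬ InvPt Ω φ z}

/-- The set R_φ = Ω ∖ π_Ω(C_φ). -/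
def Rphi {n p : ℕ} (Ω : Set (Euc n)) (φ : ℝ → Euc n × Euc p → ℝ) : Set (Euc n) :=
  Ω \ (Prod.fst '' Cphi Ω φ)

/-- The set C^sc_φ. -/
def CphiSc {n p : ℕ} (Ω : Set (Euc n)) (φ : ℝ → Euc n × Euc p → ℝ) : Set (Euc n × Euc p) :=
  {z | z.1 ∈ Ω ∧ z.2 ≠ 0 ∧ ¬ InvPtSc Ω φ z}

/-- The set R^sc_φ = Ω ∖ π_Ω(C^sc_φ). -/
def RphiSc {n p : ℕ} (Ω : Set (Euc n)) (φ : ℝ → Euc n × Euc p → ℝ) : Set (Euc n) :=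
  Ω \ (Prod.fst '' CphiSc Ω φ)

/-- 1/|∇_ξφ(y,ξ/|ξ|)|². -/
def varphiXi {n p : ℕ} (φ : Euc n × Euc p → ℝ) (z : Euc n × Euc p) : ℝ :=
  (gradXiSq φ (z.1, ‖z.2‖⁻¹ • z.2))⁻¹

/-- The transposed regularizing operator in the ξ-variables only:
    ᵗL f = −Σ_j a_j ∂_{ξ_j} f + χ f  with a_j = i(1−χ)|∇_ξφ|⁻²∂_{ξ_j}φ. -/
def tLxi {n p : ℕ} (χ : Euc p → ℝ) (φ : Euc n × Euc p → ℝ) (f : Euc n × Euc p → ℂ) :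
    Euc n × Euc p → ℂ :=
  fun z => -(∑ j : Fin p,
      (Complex.I * (((1 - χ z.2) * varphiXi φ z * dirD (eXi j) φ z : ℝ) : ℂ)) *
        dirD (eXi j) f z)
    + ((χ z.2 : ℝ) : ℂ) * f z

/-- d_{j}(y,θ,ξ) = (ξ_j − ∂_{y_j}φ(y,θ))/|ξ−∇_yφ(y,θ)|². -/
def dj {n p : ℕ} (φ : Euc n × Euc p → ℝ) (ξ : Euc n) (j : Fin n)
    (z : Euc n × Euc p) : ℝ :=
  (ξ j - dirD (eY j) φ z) / ‖ξ - gradY φ z‖ ^ 2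

/-- ᵗL_ε f = −Σ_j d_j D_{y_j} f − Σ_j (D_{y_j} d_j) f, with D_{y_j} = −i∂_{y_j}. -/
def tLW {n p : ℕ} (φ : Euc n × Euc p → ℝ) (ξ : Euc n) (f : Euc n × Euc p → ℂ) :
    Euc n × Euc p → ℂ :=
  fun z => -(∑ j : Fin n, ((dj φ ξ j z : ℝ) : ℂ) * (-Complex.I * dirD (eY j) f z))
    - ∑ j : Fin n, (-Complex.I * ((dirD (eY j) (dj φ ξ j) z : ℝ) : ℂ)) * f z

open Asymptotics Filter

/-! ### Directional derivatives on open sets -/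

section DirectionalDerivatives

variable {E F H : Type*} [NormedAddCommGroup E] [NormedSpace ℝ E]
  [NormedAddCommGroup F] [NormedSpace ℝ F] [NormedAddCommGroup H] [NormedSpace ℝ H]

lemma dirD_eqOn {U : Set E} (hU : IsOpen U) {f g : E → F} (h : EqOn f g U) (v : E) :
    EqOn (dirD v f) (dirD v g) U := by
  intro x hx
  have : f =ᶠ[𝓝 x] g := h.eventuallyEq_of_mem (hU.mem_nhds hx)
  simp only [dirD, this.fderiv_eq]

lemma dirDs_eqOn {U : Set E} (hU : IsOpen U) {f g : E → F} (h : EqOn f g U) (L : List E) :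
    EqOn (dirDs L f) (dirDs L g) U := by
  induction L with
  | nil => exact h
  | cons v L ih => exact dirD_eqOn hU ih v

lemma dirDs_zero (L : List E) : dirDs L (fun _ => (0 : F)) = fun _ => 0 := by
  induction L with
  | nil => rfl
  | cons v L ih =>
    change dirD v (dirDs L _) = _
    rw [ih]
    funext x
    simp [dirD]

lemma contDiffOn_dirD {U : Set E} (hU : IsOpen U) {f : E → F}
    (hf : ContDiffOn ℝ (⊤ : ℕ∞) f U) (v : E) : ContDiffOn ℝ (⊤ : ℕ∞) (dirD v f) U :=
  (hf.fderiv_of_isOpen hU (by simp)).clm_apply contDiffOn_const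

lemma differentiableAt_of_smoothOn {U : Set E} (hU : IsOpen U) {f : E → F}
    (hf : ContDiffOn ℝ (⊤ : ℕ∞) f U) {x : E} (hx : x ∈ U) : DifferentiableAt ℝ f x :=
  (hf.contDiffAt (hU.mem_nhds hx)).differentiableAt (by simp)

lemma contDiffOn_dirDs {U : Set E} (hU : IsOpen U) {f : E → F}
    (hf : ContDiffOn ℝ (⊤ : ℕ∞) f U) (L : List E) : ContDiffOn ℝ (⊤ : ℕ∞) (dirDs L f) U := by
  induction L with
  | nil => exact hf
  | cons v L ih => exact contDiffOn_dirD hU ih v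

lemma dirD_comm {U : Set E} (hU : IsOpen U) {f : E → F}
    (hf : ContDiffOn ℝ (⊤ : ℕ∞) f U) (v w : E) :
    EqOn (dirD v (dirD w f)) (dirD w (dirD v f)) U := by
  intro x hx
  have hfx := hf.contDiffAt (hU.mem_nhds hx)
  have hsymm : IsSymmSndFDerivAt ℝ f x := hfx.isSymmSndFDerivAt (by
    rw [minSmoothness_of_isRCLikeNormedField]
    exact WithTop.coe_le_coe.2 (le_top : (2 : ℕ∞) ≤ ⊤))
  have hd : DifferentiableAt ℝ (fderiv ℝ f) x :=
    differentiableAt_of_smoothOn hU (hf.fderiv_of_isOpen hU (by simp)) hx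
  have key : ∀ a b : E, dirD a (dirD b f) x = fderiv ℝ (fderiv ℝ f) x a b := by
    intro a b
    change fderiv ℝ (fun z => fderiv ℝ f z b) x a = _
    rw [fderiv_clm_apply hd (differentiableAt_const b)]
    simp
  rw [key, key, hsymm.eq]

lemma dirDs_dirD {U : Set E} (hU : IsOpen U) {f : E → F}
    (hf : ContDiffOn ℝ (⊤ : ℕ∞) f U) (L : List E) (v : E) :
    EqOn (dirDs L (dirD v f)) (dirD v (dirDs L f)) U := by
  induction L with
  | nil => exact fun _ _ => rfl
  | cons w L ih =>
    exact (dirD_eqOn hU ih w).trans (dirD_comm hU (contDiffOn_dirDs hU hf L) w v)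

lemma dirDs_append (L M : List E) (f : E → F) : dirDs (L ++ M) f = dirDs L (dirDs M f) :=
  List.foldr_append

lemma dirD_add {U : Set E} (hU : IsOpen U) {f g : E → F}
    (hf : ContDiffOn ℝ (⊤ : ℕ∞) f U) (hg : ContDiffOn ℝ (⊤ : ℕ∞) g U) (v : E) :
    EqOn (dirD v (fun x => f x + g x)) (fun x => dirD v f x + dirD v g x) U := by
  intro x hx
  simp only [dirD]
  rw [fderiv_fun_add (differentiableAt_of_smoothOn hU hf hx)
    (differentiableAt_of_smoothOn hU hg hx)]
  rfl

lemma dirD_sub {U : Set E} (hU : IsOpen U) {f g : E → F}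
    (hf : ContDiffOn ℝ (⊤ : ℕ∞) f U) (hg : ContDiffOn ℝ (⊤ : ℕ∞) g U) (v : E) :
    EqOn (dirD v (fun x => f x - g x)) (fun x => dirD v f x - dirD v g x) U := by
  intro x hx
  simp only [dirD]
  rw [fderiv_fun_sub (differentiableAt_of_smoothOn hU hf hx)
    (differentiableAt_of_smoothOn hU hg hx)]
  rfl

lemma dirD_mul {U : Set E} (hU : IsOpen U) {f g : E → ℝ}
    (hf : ContDiffOn ℝ (⊤ : ℕ∞) f U) (hg : ContDiffOn ℝ (⊤ : ℕ∞) g U) (v : E) :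
    EqOn (dirD v (fun x => f x * g x)) (fun x => dirD v f x * g x + f x * dirD v g x) U := by
  intro x hx
  simp only [dirD]
  rw [fderiv_fun_mul (differentiableAt_of_smoothOn hU hf hx)
    (differentiableAt_of_smoothOn hU hg hx)]
  simp
  ring

lemma dirD_inv {U : Set E} (hU : IsOpen U) {f : E → ℝ}
    (hf : ContDiffOn ℝ (⊤ : ℕ∞) f U) (h0 : ∀ x ∈ U, f x ≠ 0) (v : E) :
    EqOn (dirD v (fun x => (f x)⁻¹)) (fun x => -1 * ((f x)⁻¹ * (f x)⁻¹ * dirD v f x)) U := by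
  intro x hx
  have := ((hasDerivAt_inv (h0 x hx)).comp_hasFDerivAt x
    (differentiableAt_of_smoothOn hU hf hx).hasFDerivAt).fderiv
  simp only [dirD]
  erw [this]
  simp [pow_two]

lemma dirD_clm_comp {U : Set E} (hU : IsOpen U) {f : E → F}
    (hf : ContDiffOn ℝ (⊤ : ℕ∞) f U) (T : F →L[ℝ] H) (v : E) :
    EqOn (dirD v (fun x => T (f x))) (fun x => T (dirD v f x)) U := by
  intro x hx
  have := (T.hasFDerivAt.comp x (differentiableAt_of_smoothOn hU hf hx).hasFDerivAt).fderiv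
  simp only [dirD]
  erw [this]
  rfl

end DirectionalDerivatives

/-! ### Growth scales -/

/-- Moderate growth of a net of numbers as `ε → 0`. -/
def ModerateScale (g : ℝ → ℝ) : Prop :=
  ∃ N : ℕ, g =O[𝓝[>] 0] fun ε : ℝ => ε ^ (-(N : ℤ))

/-- Negligibility of a net of numbers as `ε → 0`. -/
def NegligibleScale (g : ℝ → ℝ) : Prop :=
  ∀ q : ℕ, g =O[𝓝[>] 0] fun ε : ℝ => ε ^ q

/-- A class of nets of numbers that is a module over the moderate nets. -/
structure IsGrowthScale (G : (ℝ → ℝ) → Prop) : Prop where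
  add : ∀ g h, G g → G h → G (fun ε => |g ε| + |h ε|)
  mul : ∀ g h, ModerateScale g → G h → G (fun ε => g ε * h ε)

lemma isBigO_zpow_of_le {M N : ℕ} (h : M ≤ N) :
    (fun ε : ℝ => ε ^ (-(M : ℤ))) =O[𝓝[>] 0] fun ε : ℝ => ε ^ (-(N : ℤ)) := by
  refine IsBigO.of_bound 1 ?_
  have : Ioc (0 : ℝ) 1 ∈ 𝓝[>] (0 : ℝ) := Ioc_mem_nhdsGT one_pos
  filter_upwards [this] with ε hε
  have h1 : ∀ k : ℤ, ‖ε ^ k‖ = ε ^ k := fun k => by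
    rw [Real.norm_eq_abs, abs_of_nonneg (zpow_nonneg hε.1.le _)]
  rw [h1, h1, one_mul]
  exact zpow_le_zpow_right_of_le_one₀ hε.1 hε.2 (by omega)

lemma ModerateScale.mul {g h : ℝ → ℝ} (hg : ModerateScale g) (hh : ModerateScale h) :
    ModerateScale (fun ε => g ε * h ε) := by
  obtain ⟨M, hM⟩ := hg
  obtain ⟨N, hN⟩ := hh
  refine ⟨M + N, (hM.mul hN).congr' EventuallyEq.rfl ?_⟩
  filter_upwards [self_mem_nhdsWithin] with ε hε
  rw [← zpow_add₀ (ne_of_gt hε)]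
  congr 1
  push_cast
  ring

lemma isGrowthScale_moderate : IsGrowthScale ModerateScale where
  add g h hg hh := by
    obtain ⟨M, hM⟩ := hg
    obtain ⟨N, hN⟩ := hh
    refine ⟨max M N, ?_⟩
    exact (hM.trans (isBigO_zpow_of_le (le_max_left _ _))).norm_left.add
      (hN.trans (isBigO_zpow_of_le (le_max_right _ _))).norm_left
  mul _ _ hg hh := hg.mul hh

lemma isGrowthScale_negligible : IsGrowthScale NegligibleScale where
  add g h hg hh q := (hg q).norm_left.add (hh q).norm_left
  mul g h hg hh q := by
    obtain ⟨N, hN⟩ := hg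
    refine (hN.mul (hh (N + q))).congr' EventuallyEq.rfl ?_
    filter_upwards [self_mem_nhdsWithin] with ε hε
    rw [← zpow_natCast, ← zpow_natCast, ← zpow_add₀ (ne_of_gt hε)]
    congr 1
    push_cast
    ring

lemma moderateScale_const (c : ℝ) : ModerateScale (fun _ => c) :=
  ⟨0, by simpa using isBigO_const_const c (one_ne_zero (α := ℝ)) (𝓝[>] (0 : ℝ))⟩

/-! ### Symbol classes on the cone `Ω × (ℝ^p ∖ 0)` -/

section Symbols

variable {n p : ℕ} {F H : Type*} [NormedAddCommGroup F] [NormedSpace ℝ F]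
  [NormedAddCommGroup H] [NormedSpace ℝ H]

/-- The conic domain `Ω × (ℝ^p ∖ 0)`. -/
def coneDom (p : ℕ) {n : ℕ} (Ω : Set (Euc n)) : Set (Euc n × Euc p) :=
  Ω ×ˢ {ξ : Euc p | ξ ≠ 0}

lemma isOpen_coneDom {Ω : Set (Euc n)} (hΩ : IsOpen Ω) : IsOpen (coneDom p Ω) :=
  hΩ.prod isOpen_ne

/-- Order `m` bound for a net on the cone, with growth in `ε` controlled by `G`. -/
def SymbBound (G : (ℝ → ℝ) → Prop) (Ω : Set (Euc n)) (m : ℝ)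
    (f : ℝ → Euc n × Euc p → F) : Prop :=
  ∀ K ⊆ Ω, IsCompact K → ∃ g : ℝ → ℝ, G g ∧ ∀ ε ∈ Ioc (0 : ℝ) 1, ∀ y ∈ K, ∀ ξ : Euc p, ξ ≠ 0 →
    ‖f ε (y, ξ)‖ ≤ |g ε| * ‖ξ‖ ^ m

/-- Symbol bounds for all derivatives up to a given order. -/
def SymbBoundUpTo (G : (ℝ → ℝ) → Prop) (Ω : Set (Euc n)) :
    ℕ → ℝ → (ℝ → Euc n × Euc p → F) → Prop
  | 0, m, f => SymbBound G Ω m f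
  | k + 1, m, f => SymbBound G Ω m f ∧
      (∀ j : Fin p, SymbBoundUpTo G Ω k (m - 1) (fun ε => dirD (eXi j) (f ε))) ∧
      ∀ i : Fin n, SymbBoundUpTo G Ω k m (fun ε => dirD (eY i) (f ε))

/-- Nets of smooth functions on the cone. -/
def SmoothNet (Ω : Set (Euc n)) (f : ℝ → Euc n × Euc p → F) : Prop :=
  ∀ ε ∈ Ioc (0 : ℝ) 1, ContDiffOn ℝ (⊤ : ℕ∞) (f ε) (coneDom p Ω)

/-- Nets of symbols of order `m` on the cone, with growth in `ε` controlled by `G`. -/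
structure IsConeSymb (G : (ℝ → ℝ) → Prop) (Ω : Set (Euc n)) (m : ℝ)
    (f : ℝ → Euc n × Euc p → F) : Prop where
  smooth : SmoothNet Ω f
  bound : ∀ k, SymbBoundUpTo G Ω k m f

variable {G : (ℝ → ℝ) → Prop} {Ω : Set (Euc n)} {m m' : ℝ}

lemma SmoothNet.dirD (hΩ : IsOpen Ω) {f : ℝ → Euc n × Euc p → F} (hf : SmoothNet Ω f)
    (v : Euc n × Euc p) : SmoothNet Ω (fun ε => dirD v (f ε)) :=
  fun ε hε => contDiffOn_dirD (isOpen_coneDom hΩ) (hf ε hε) v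

omit [NormedSpace ℝ F] in
lemma SymbBound.congr {f g : ℝ → Euc n × Euc p → F} (hf : SymbBound G Ω m f)
    (h : ∀ ε ∈ Ioc (0 : ℝ) 1, EqOn (g ε) (f ε) (coneDom p Ω)) : SymbBound G Ω m g := by
  intro K hK hKc
  obtain ⟨b, hb, hB⟩ := hf K hK hKc
  refine ⟨b, hb, fun ε hε y hy ξ hξ => ?_⟩
  rw [h ε hε (show (y, ξ) ∈ coneDom p Ω from ⟨hK hy, hξ⟩)]
  exact hB ε hε y hy ξ hξ

omit [NormedSpace ℝ F] in
lemma SymbBound.add (hG : IsGrowthScale G) {f g : ℝ → Euc n × Euc p → F}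
    (hf : SymbBound G Ω m f) (hg : SymbBound G Ω m g) :
    SymbBound G Ω m (fun ε z => f ε z + g ε z) := by
  intro K hK hKc
  obtain ⟨b, hb, hB⟩ := hf K hK hKc
  obtain ⟨c, hc, hC⟩ := hg K hK hKc
  refine ⟨_, hG.add b c hb hc, fun ε hε y hy ξ hξ => ?_⟩
  rw [abs_of_nonneg (by positivity), add_mul]
  exact norm_add_le_of_le (hB ε hε y hy ξ hξ) (hC ε hε y hy ξ hξ)

lemma SymbBound.mul (hG : IsGrowthScale G) {f g : ℝ → Euc n × Euc p → ℝ}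
    (hf : SymbBound ModerateScale Ω m f) (hg : SymbBound G Ω m' g) :
    SymbBound G Ω (m + m') (fun ε z => f ε z * g ε z) := by
  intro K hK hKc
  obtain ⟨b, hb, hB⟩ := hf K hK hKc
  obtain ⟨c, hc, hC⟩ := hg K hK hKc
  refine ⟨_, hG.mul b c hb hc, fun ε hε y hy ξ hξ => ?_⟩
  rw [abs_mul, norm_mul, Real.rpow_add (norm_pos_iff.2 hξ), mul_mul_mul_comm]
  exact mul_le_mul (hB ε hε y hy ξ hξ) (hC ε hε y hy ξ hξ) (norm_nonneg _) (by positivity)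

lemma SymbBound.clm_comp (hG : IsGrowthScale G) {f : ℝ → Euc n × Euc p → F}
    (hf : SymbBound G Ω m f) (T : F →L[ℝ] H) : SymbBound G Ω m (fun ε z => T (f ε z)) := by
  intro K hK hKc
  obtain ⟨b, hb, hB⟩ := hf K hK hKc
  refine ⟨_, hG.mul _ b (moderateScale_const ‖T‖) hb, fun ε hε y hy ξ hξ => ?_⟩
  rw [abs_mul, abs_of_nonneg (norm_nonneg T), mul_assoc]
  exact (T.le_opNorm _).trans (by gcongr; exact hB ε hε y hy ξ hξ)

namespace SymbBoundUpTo

lemma zeroth {k : ℕ} {f : ℝ → Euc n × Euc p → F} (hf : SymbBoundUpTo G Ω k m f) :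
    SymbBound G Ω m f := by
  cases k with
  | zero => exact hf
  | succ k => exact hf.1

lemma of_succ {k : ℕ} {f : ℝ → Euc n × Euc p → F} (hf : SymbBoundUpTo G Ω (k + 1) m f) :
    SymbBoundUpTo G Ω k m f := by
  induction k generalizing m f with
  | zero => exact hf.1
  | succ k ih => exact ⟨hf.1, fun j => ih (hf.2.1 j), fun i => ih (hf.2.2 i)⟩

lemma congr (hΩ : IsOpen Ω) {k : ℕ} {f g : ℝ → Euc n × Euc p → F}
    (hf : SymbBoundUpTo G Ω k m f)
    (h : ∀ ε ∈ Ioc (0 : ℝ) 1, EqOn (g ε) (f ε) (coneDom p Ω)) : SymbBoundUpTo G Ω k m g := by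
  induction k generalizing m f g with
  | zero => exact SymbBound.congr hf h
  | succ k ih =>
    exact ⟨hf.1.congr h,
      fun j => ih (hf.2.1 j) fun ε hε => dirD_eqOn (isOpen_coneDom hΩ) (h ε hε) _,
      fun i => ih (hf.2.2 i) fun ε hε => dirD_eqOn (isOpen_coneDom hΩ) (h ε hε) _⟩

lemma add (hΩ : IsOpen Ω) (hG : IsGrowthScale G) {k : ℕ} {f g : ℝ → Euc n × Euc p → F}
    (hfs : SmoothNet Ω f) (hgs : SmoothNet Ω g)
    (hf : SymbBoundUpTo G Ω k m f) (hg : SymbBoundUpTo G Ω k m g) :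
    SymbBoundUpTo G Ω k m (fun ε z => f ε z + g ε z) := by
  induction k generalizing m f g with
  | zero => exact SymbBound.add hG hf hg
  | succ k ih =>
    exact ⟨hf.1.add hG hg.1,
      fun j => (ih (hfs.dirD hΩ _) (hgs.dirD hΩ _) (hf.2.1 j) (hg.2.1 j)).congr hΩ
        fun ε hε => dirD_add (isOpen_coneDom hΩ) (hfs ε hε) (hgs ε hε) _,
      fun i => (ih (hfs.dirD hΩ _) (hgs.dirD hΩ _) (hf.2.2 i) (hg.2.2 i)).congr hΩ
        fun ε hε => dirD_add (isOpen_coneDom hΩ) (hfs ε hε) (hgs ε hε) _⟩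

lemma clm_comp (hΩ : IsOpen Ω) (hG : IsGrowthScale G) {k : ℕ} {f : ℝ → Euc n × Euc p → F}
    (hfs : SmoothNet Ω f) (hf : SymbBoundUpTo G Ω k m f) (T : F →L[ℝ] H) :
    SymbBoundUpTo G Ω k m (fun ε z => T (f ε z)) := by
  induction k generalizing m f with
  | zero => exact SymbBound.clm_comp hG hf T
  | succ k ih =>
    exact ⟨hf.1.clm_comp hG T,
      fun j => (ih (hfs.dirD hΩ _) (hf.2.1 j)).congr hΩ
        fun ε hε => dirD_clm_comp (isOpen_coneDom hΩ) (hfs ε hε) T _,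
      fun i => (ih (hfs.dirD hΩ _) (hf.2.2 i)).congr hΩ
        fun ε hε => dirD_clm_comp (isOpen_coneDom hΩ) (hfs ε hε) T _⟩

lemma mul (hΩ : IsOpen Ω) (hG : IsGrowthScale G) {k : ℕ} {f g : ℝ → Euc n × Euc p → ℝ}
    (hfs : SmoothNet Ω f) (hgs : SmoothNet Ω g)
    (hf : SymbBoundUpTo ModerateScale Ω k m f) (hg : SymbBoundUpTo G Ω k m' g) :
    SymbBoundUpTo G Ω k (m + m') (fun ε z => f ε z * g ε z) := by
  induction k generalizing m m' f g with
  | zero => exact SymbBound.mul hG hf hg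
  | succ k ih =>
    have hf' := hf.of_succ
    have hg' := hg.of_succ
    have smul : ∀ {a b : ℝ → Euc n × Euc p → ℝ}, SmoothNet Ω a → SmoothNet Ω b →
        SmoothNet Ω (fun ε z => a ε z * b ε z) := fun ha hb ε hε => (ha ε hε).mul (hb ε hε)
    refine ⟨hf.1.mul hG hg.1, fun j => ?_, fun i => ?_⟩
    · have h1 := ih (hfs.dirD hΩ _) hgs (hf.2.1 j) hg'
      have h2 := ih hfs (hgs.dirD hΩ _) hf' (hg.2.1 j)
      rw [show m - 1 + m' = m + m' - 1 by ring] at h1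
      rw [show m + (m' - 1) = m + m' - 1 by ring] at h2
      exact (add hΩ hG (smul (hfs.dirD hΩ _) hgs) (smul hfs (hgs.dirD hΩ _)) h1 h2).congr hΩ
        fun ε hε => dirD_mul (isOpen_coneDom hΩ) (hfs ε hε) (hgs ε hε) _
    · have h1 := ih (hfs.dirD hΩ _) hgs (hf.2.2 i) hg'
      have h2 := ih hfs (hgs.dirD hΩ _) hf' (hg.2.2 i)
      exact (add hΩ hG (smul (hfs.dirD hΩ _) hgs) (smul hfs (hgs.dirD hΩ _)) h1 h2).congr hΩ
        fun ε hε => dirD_mul (isOpen_coneDom hΩ) (hfs ε hε) (hgs ε hε) _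

end SymbBoundUpTo

namespace IsConeSymb

lemma congr (hΩ : IsOpen Ω) {f g : ℝ → Euc n × Euc p → F} (hf : IsConeSymb G Ω m f)
    (h : ∀ ε ∈ Ioc (0 : ℝ) 1, EqOn (g ε) (f ε) (coneDom p Ω)) : IsConeSymb G Ω m g :=
  ⟨fun ε hε => (hf.smooth ε hε).congr (h ε hε), fun k => (hf.bound k).congr hΩ h⟩

lemma add (hΩ : IsOpen Ω) (hG : IsGrowthScale G) {f g : ℝ → Euc n × Euc p → F}
    (hf : IsConeSymb G Ω m f) (hg : IsConeSymb G Ω m g) :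
    IsConeSymb G Ω m (fun ε z => f ε z + g ε z) :=
  ⟨fun ε hε => (hf.smooth ε hε).add (hg.smooth ε hε),
    fun k => (hf.bound k).add hΩ hG hf.smooth hg.smooth (hg.bound k)⟩

lemma mul (hΩ : IsOpen Ω) (hG : IsGrowthScale G) {f g : ℝ → Euc n × Euc p → ℝ}
    (hf : IsConeSymb ModerateScale Ω m f) (hg : IsConeSymb G Ω m' g) :
    IsConeSymb G Ω (m + m') (fun ε z => f ε z * g ε z) :=
  ⟨fun ε hε => (hf.smooth ε hε).mul (hg.smooth ε hε),
    fun k => (hf.bound k).mul hΩ hG hf.smooth hg.smooth (hg.bound k)⟩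

lemma clm_comp (hΩ : IsOpen Ω) (hG : IsGrowthScale G) {f : ℝ → Euc n × Euc p → F}
    (hf : IsConeSymb G Ω m f) (T : F →L[ℝ] H) : IsConeSymb G Ω m (fun ε z => T (f ε z)) :=
  ⟨fun ε hε => T.contDiff.comp_contDiffOn (hf.smooth ε hε),
    fun k => (hf.bound k).clm_comp hΩ hG hf.smooth T⟩

lemma dirD_eXi (hΩ : IsOpen Ω) {f : ℝ → Euc n × Euc p → F} (hf : IsConeSymb G Ω m f)
    (j : Fin p) : IsConeSymb G Ω (m - 1) (fun ε => dirD (eXi j) (f ε)) :=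
  ⟨hf.smooth.dirD hΩ _, fun k => (hf.bound (k + 1)).2.1 j⟩

lemma dirD_eY (hΩ : IsOpen Ω) {f : ℝ → Euc n × Euc p → F} (hf : IsConeSymb G Ω m f)
    (i : Fin n) : IsConeSymb G Ω m (fun ε => dirD (eY i) (f ε)) :=
  ⟨hf.smooth.dirD hΩ _, fun k => (hf.bound (k + 1)).2.2 i⟩

lemma dirDs (hΩ : IsOpen Ω) {f : ℝ → Euc n × Euc p → F} (hf : IsConeSymb G Ω m f)
    (α : List (Fin p)) (β : List (Fin n)) :
    IsConeSymb G Ω (m - α.length) (fun ε => dirDs (α.map eXi ++ β.map eY) (f ε)) := by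
  induction α with
  | nil =>
    simp only [List.length_nil, Nat.cast_zero, sub_zero, List.map_nil, List.nil_append]
    induction β with
    | nil => exact hf
    | cons i β ih => exact ih.dirD_eY hΩ i
  | cons j α ih =>
    have h := ih.dirD_eXi hΩ j
    rw [sub_sub] at h
    rw [List.length_cons, Nat.cast_add, Nat.cast_one]
    exact h

lemma zero (hG : G (fun _ => 0)) :
    IsConeSymb G Ω m (fun (_ : ℝ) (_ : Euc n × Euc p) => (0 : F)) := by
  refine ⟨fun ε _ => contDiffOn_const, fun k => ?_⟩
  have hB : ∀ m : ℝ, SymbBound G Ω m (fun (_ : ℝ) (_ : Euc n × Euc p) => (0 : F)) :=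
    fun m K _ _ => ⟨_, hG, by simp⟩
  have hd : ∀ v : Euc n × Euc p, _root_.dirD v (fun _ : Euc n × Euc p => (0 : F)) = fun _ => 0 :=
    fun v => by funext z; simp [_root_.dirD]
  induction k generalizing m with
  | zero => exact hB m
  | succ k ih => exact ⟨hB m, fun j => by simpa only [hd] using ih, fun i => by simpa only [hd] using ih⟩

lemma sum (hΩ : IsOpen Ω) (hG : IsGrowthScale G) (h0 : G (fun _ => 0)) {ι : Type*}
    (s : Finset ι) {f : ι → ℝ → Euc n × Euc p → F} (hf : ∀ i, IsConeSymb G Ω m (f i)) :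
    IsConeSymb G Ω m (fun ε z => ∑ i ∈ s, f i ε z) := by
  classical
  induction s using Finset.induction_on with
  | empty => simpa using zero h0
  | insert i s hi ih =>
    simp only [Finset.sum_insert hi]
    exact (hf i).add hΩ hG ih

/-- A symbol whose first derivatives are symbols. -/
lemma of_deriv {f : ℝ → Euc n × Euc p → F} (hs : SmoothNet Ω f) (hb : SymbBound G Ω m f)
    (hXi : ∀ j, IsConeSymb G Ω (m - 1) (fun ε => _root_.dirD (eXi j) (f ε)))
    (hY : ∀ i, IsConeSymb G Ω m (fun ε => _root_.dirD (eY i) (f ε))) : IsConeSymb G Ω m f := by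
  refine ⟨hs, fun k => ?_⟩
  cases k with
  | zero => exact hb
  | succ k => exact ⟨hb, fun j => (hXi j).bound k, fun i => (hY i).bound k⟩

lemma const (c : F) :
    IsConeSymb ModerateScale Ω 0 (fun (_ : ℝ) (_ : Euc n × Euc p) => c) := by
  have hd : ∀ v : Euc n × Euc p, _root_.dirD v (fun _ : Euc n × Euc p => c) = fun _ => 0 :=
    fun v => by funext z; simp [_root_.dirD]
  refine of_deriv (fun ε _ => contDiffOn_const) ?_ (fun j => ?_) fun i => ?_
  · exact fun K _ _ => ⟨_, moderateScale_const ‖c‖, by simp⟩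
  · simpa only [hd] using zero (moderateScale_const 0)
  · simpa only [hd] using zero (moderateScale_const 0)

lemma inv (hΩ : IsOpen Ω) {f : ℝ → Euc n × Euc p → ℝ} (hf : IsConeSymb ModerateScale Ω m f)
    (h0 : ∀ ε ∈ Ioc (0 : ℝ) 1, ∀ z ∈ coneDom p Ω, f ε z ≠ 0)
    (hb : SymbBound ModerateScale Ω (-m) (fun ε z => (f ε z)⁻¹)) :
    IsConeSymb ModerateScale Ω (-m) (fun ε z => (f ε z)⁻¹) := by
  have hG := isGrowthScale_moderate
  have hs : SmoothNet Ω (fun ε z => (f ε z)⁻¹) :=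
    fun ε hε => (hf.smooth ε hε).inv (h0 ε hε)
  have hs2 : SmoothNet Ω (fun ε z => (f ε z)⁻¹ * (f ε z)⁻¹) :=
    fun ε hε => (hs ε hε).mul (hs ε hε)
  have hs3 : ∀ v, SmoothNet Ω (fun ε z => (f ε z)⁻¹ * (f ε z)⁻¹ * _root_.dirD v (f ε) z) :=
    fun v ε hε => (hs2 ε hε).mul (hf.smooth.dirD hΩ v ε hε)
  refine ⟨hs, fun k => ?_⟩
  induction k with
  | zero => exact hb
  | succ k ih =>
    have h2 := ih.mul hΩ hG hs hs ih
    refine ⟨hb, fun j => ?_, fun i => ?_⟩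
    · have h3 := h2.mul hΩ hG hs2 (hf.smooth.dirD hΩ _) ((hf.dirD_eXi hΩ j).bound k)
      have h4 := ((const (-1 : ℝ)).bound k).mul hΩ hG (const (-1 : ℝ)).smooth (hs3 _) h3
      rw [show 0 + (-m + -m + (m - 1)) = -m - 1 by ring] at h4
      exact h4.congr hΩ fun ε hε =>
        dirD_inv (isOpen_coneDom hΩ) (hf.smooth ε hε) (h0 ε hε) _
    · have h3 := h2.mul hΩ hG hs2 (hf.smooth.dirD hΩ _) ((hf.dirD_eY hΩ i).bound k)
      have h4 := ((const (-1 : ℝ)).bound k).mul hΩ hG (const (-1 : ℝ)).smooth (hs3 _) h3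
      rw [show 0 + (-m + -m + m) = -m by ring] at h4
      exact h4.congr hΩ fun ε hε =>
        dirD_inv (isOpen_coneDom hΩ) (hf.smooth ε hε) (h0 ε hε) _

end IsConeSymb

/-! ### Positively homogeneous functions -/

/-- Smooth functions on the cone that are positively homogeneous of degree `m` in `ξ`. -/
structure IsHomog (Ω : Set (Euc n)) (m : ℝ) (f : Euc n × Euc p → ℝ) : Prop where
  smooth : ContDiffOn ℝ (⊤ : ℕ∞) f (coneDom p Ω)
  hom : ∀ y ∈ Ω, ∀ ξ : Euc p, ξ ≠ 0 → ∀ t : ℝ, 0 < t → f (y, t • ξ) = t ^ m * f (y, ξ)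

namespace IsHomog

lemma fderiv_smul (hΩ : IsOpen Ω) {f : Euc n × Euc p → ℝ} (hf : IsHomog Ω m f)
    {y : Euc n} (hy : y ∈ Ω) {ξ : Euc p} (hξ : ξ ≠ 0) {t : ℝ} (ht : 0 < t) (v : Euc n × Euc p) :
    fderiv ℝ f (y, t • ξ) (v.1, t • v.2) = t ^ m * fderiv ℝ f (y, ξ) v := by
  have hU := isOpen_coneDom (p := p) hΩ
  have hz : (y, ξ) ∈ coneDom p Ω := ⟨hy, hξ⟩
  have hz' : (y, t • ξ) ∈ coneDom p Ω := ⟨hy, smul_ne_zero ht.ne' hξ⟩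
  let T : Euc n × Euc p →L[ℝ] Euc n × Euc p :=
    (ContinuousLinearMap.id ℝ (Euc n)).prodMap (t • ContinuousLinearMap.id ℝ (Euc p))
  have h1 : HasFDerivAt (f ∘ T) ((fderiv ℝ f (y, t • ξ)).comp T) (y, ξ) :=
    HasFDerivAt.comp (y, ξ) (differentiableAt_of_smoothOn hU hf.smooth hz').hasFDerivAt
      T.hasFDerivAt
  have h2 : HasFDerivAt (fun z => t ^ m * f z) (t ^ m • fderiv ℝ f (y, ξ)) (y, ξ) :=
    (differentiableAt_of_smoothOn hU hf.smooth hz).hasFDerivAt.const_mul _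
  have he : (f ∘ T) =ᶠ[𝓝 (y, ξ)] fun z => t ^ m * f z :=
    eventuallyEq_of_mem (hU.mem_nhds hz) fun z hz => hf.hom z.1 hz.1 z.2 hz.2 t ht
  exact congrArg (fun A => A v) (h1.unique (h2.congr_of_eventuallyEq he))

lemma dirD_eY (hΩ : IsOpen Ω) {f : Euc n × Euc p → ℝ} (hf : IsHomog Ω m f) (i : Fin n) :
    IsHomog Ω m (dirD (eY i) f) := by
  refine ⟨contDiffOn_dirD (isOpen_coneDom hΩ) hf.smooth _, fun y hy ξ hξ t ht => ?_⟩
  simpa [dirD, eY] using hf.fderiv_smul hΩ hy hξ ht (eY i)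

lemma dirD_eXi (hΩ : IsOpen Ω) {f : Euc n × Euc p → ℝ} (hf : IsHomog Ω m f) (j : Fin p) :
    IsHomog Ω (m - 1) (dirD (eXi j) f) := by
  refine ⟨contDiffOn_dirD (isOpen_coneDom hΩ) hf.smooth _, fun y hy ξ hξ t ht => ?_⟩
  have h := hf.fderiv_smul hΩ hy hξ ht (eXi j)
  have h' : ((eXi j : Euc n × Euc p).1, t • (eXi j : Euc n × Euc p).2) = t • eXi j := by
    simp [eXi]
  rw [h', map_smul, smul_eq_mul] at h
  simp only [dirD]
  rw [Real.rpow_sub_one ht.ne', div_mul_eq_mul_div, ← h]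
  field_simp

lemma exists_bound {f : Euc n × Euc p → ℝ} (hf : IsHomog Ω m f) {K : Set (Euc n)}
    (hK : K ⊆ Ω) (hKc : IsCompact K) :
    ∃ C, ∀ y ∈ K, ∀ ξ : Euc p, ξ ≠ 0 → ‖ξ‖ ^ (-m) * ‖f (y, ξ)‖ ≤ C := by
  have hsub : K ×ˢ Metric.sphere (0 : Euc p) 1 ⊆ coneDom p Ω := fun z hz =>
    ⟨hK hz.1, by
      have := hz.2
      rintro h0
      simp [h0] at this⟩
  obtain ⟨C, hC⟩ := (hKc.prod (isCompact_sphere (0 : Euc p) 1)).exists_bound_of_continuousOn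
    (hf.smooth.continuousOn.mono hsub)
  refine ⟨C, fun y hy ξ hξ => ?_⟩
  have hpos : 0 < ‖ξ‖ := norm_pos_iff.2 hξ
  have hu : ‖ξ‖⁻¹ • ξ ∈ Metric.sphere (0 : Euc p) 1 := by
    simp [norm_smul, hpos.ne']
  have h1 := hC (y, ‖ξ‖⁻¹ • ξ) ⟨hy, hu⟩
  rw [hf.hom y (hK hy) ξ hξ _ (inv_pos.2 hpos), norm_mul, Real.norm_of_nonneg (by positivity),
    Real.inv_rpow hpos.le, ← Real.rpow_neg hpos.le] at h1
  exact h1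

end IsHomog

/-- The seminorm of order `m` attached to the derivatives `α`, `β` on the set `K`. -/
def hgSeminorm (m : ℝ) (K : Set (Euc n)) (α : List (Fin p)) (β : List (Fin n))
    (f : Euc n × Euc p → ℝ) : ℝ :=
  sSup ((fun z : Euc n × Euc p => ‖z.2‖ ^ (-m + (α.length : ℝ)) *
    ‖dirDs (α.map eXi ++ β.map eY) f z‖) '' (K ×ˢ {ξ : Euc p | ξ ≠ 0}))

lemma hgSeminorm_nonneg (K : Set (Euc n)) (α : List (Fin p)) (β : List (Fin n))
    (f : Euc n × Euc p → ℝ) : 0 ≤ hgSeminorm m K α β f :=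
  Real.sSup_nonneg (by rintro _ ⟨z, -, rfl⟩; positivity)

lemma hgSeminorm_le {K : Set (Euc n)} {α : List (Fin p)} {β : List (Fin n)}
    {f : Euc n × Euc p → ℝ} {C : ℝ} (hC : 0 ≤ C)
    (h : ∀ y ∈ K, ∀ ξ : Euc p, ξ ≠ 0 → ‖ξ‖ ^ (-m + (α.length : ℝ)) *
      ‖dirDs (α.map eXi ++ β.map eY) f (y, ξ)‖ ≤ C) : hgSeminorm m K α β f ≤ C :=
  Real.sSup_le (by rintro _ ⟨z, hz, rfl⟩; exact h z.1 hz.1 z.2 hz.2) hC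

lemma hgSeminorm_dirD_eY {f : Euc n × Euc p → ℝ}
    {K : Set (Euc n)} (α : List (Fin p)) (β : List (Fin n)) (i : Fin n) :
    hgSeminorm m K α β (dirD (eY i) f) = hgSeminorm m K α (β ++ [i]) f := by
  simp only [hgSeminorm, List.map_append, dirDs_append]
  rfl

lemma hgSeminorm_dirD_eXi (hΩ : IsOpen Ω) {f : Euc n × Euc p → ℝ}
    (hf : ContDiffOn ℝ (⊤ : ℕ∞) f (coneDom p Ω)) {K : Set (Euc n)} (hK : K ⊆ Ω)
    (α : List (Fin p)) (β : List (Fin n)) (j : Fin p) :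
    hgSeminorm (m - 1) K α β (dirD (eXi j) f) = hgSeminorm m K (j :: α) β f := by
  refine congrArg sSup (image_congr fun z hz => ?_)
  have hz' : z ∈ coneDom p Ω := ⟨hK hz.1, hz.2⟩
  rw [dirDs_dirD (isOpen_coneDom hΩ) hf _ _ hz', List.length_cons, Nat.cast_add, Nat.cast_one,
    show -(m - 1) + (α.length : ℝ) = -m + (α.length + 1) by ring]
  rfl

lemma symbBound_of_isHomog {f : ℝ → Euc n × Euc p → ℝ}
    (hf : ∀ ε ∈ Ioc (0 : ℝ) 1, IsHomog Ω m (f ε))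
    (hb : ∀ K ⊆ Ω, IsCompact K →
      ∃ g, G g ∧ ∀ ε ∈ Ioc (0 : ℝ) 1, hgSeminorm m K [] [] (f ε) = g ε) : SymbBound G Ω m f := by
  intro K hK hKc
  obtain ⟨g, hg, hgε⟩ := hb K hK hKc
  refine ⟨g, hg, fun ε hε y hy ξ hξ => ?_⟩
  obtain ⟨C, hC⟩ := (hf ε hε).exists_bound hK hKc
  have hle : ‖ξ‖ ^ (-m) * ‖f ε (y, ξ)‖ ≤ hgSeminorm m K [] [] (f ε) := by
    refine le_csSup ⟨C, ?_⟩ ⟨(y, ξ), ⟨hy, hξ⟩, ?_⟩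
    · rintro _ ⟨z, hz, rfl⟩
      simpa [dirDs] using hC z.1 hz.1 z.2 hz.2
    · simp [dirDs]
  rw [hgε ε hε, Real.rpow_neg (norm_nonneg _), inv_mul_le_iff₀ (by positivity)] at hle
  rw [mul_comm]
  exact hle.trans (by gcongr; exact le_abs_self _)

lemma isConeSymb_of_isHomog (hΩ : IsOpen Ω) {f : ℝ → Euc n × Euc p → ℝ}
    (hf : ∀ ε ∈ Ioc (0 : ℝ) 1, IsHomog Ω m (f ε))
    (hb : ∀ K ⊆ Ω, IsCompact K → ∀ (α : List (Fin p)) (β : List (Fin n)),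
      ∃ g, G g ∧ ∀ ε ∈ Ioc (0 : ℝ) 1, hgSeminorm m K α β (f ε) = g ε) :
    IsConeSymb G Ω m f := by
  refine ⟨fun ε hε => (hf ε hε).smooth, fun k => ?_⟩
  induction k generalizing m f with
  | zero => exact symbBound_of_isHomog hf fun K hK hKc => hb K hK hKc [] []
  | succ k ih =>
    refine ⟨symbBound_of_isHomog hf fun K hK hKc => hb K hK hKc [] [],
      fun j => ih (fun ε hε => (hf ε hε).dirD_eXi hΩ j) ?_,
      fun i => ih (fun ε hε => (hf ε hε).dirD_eY hΩ i) ?_⟩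
    · intro K hK hKc α β
      obtain ⟨g, hg, hgε⟩ := hb K hK hKc (j :: α) β
      exact ⟨g, hg, fun ε hε => by
        rw [hgSeminorm_dirD_eXi hΩ (hf ε hε).smooth hK, hgε ε hε]⟩
    · intro K hK hKc α β
      obtain ⟨g, hg, hgε⟩ := hb K hK hKc α (β ++ [i])
      exact ⟨g, hg, fun ε hε => by rw [hgSeminorm_dirD_eY, hgε ε hε]⟩

lemma HgModerate.isConeSymb (hΩ : IsOpen Ω) {f : ℝ → Euc n × Euc p → ℝ}
    (hf : ∀ ε ∈ Ioc (0 : ℝ) 1, IsHomog Ω m (f ε)) (hb : HgModerate Ω m f) :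
    IsConeSymb ModerateScale Ω m f := by
  refine isConeSymb_of_isHomog hΩ hf fun K hK hKc α β => ⟨_, ?_, fun _ _ => rfl⟩
  obtain ⟨N, C, hC, η, hη, h⟩ := hb K hK hKc α β
  refine ⟨N, IsBigO.of_bound C ?_⟩
  filter_upwards [Ioc_mem_nhdsGT hη.1] with ε hε
  have hp : 0 ≤ ε ^ (-(N : ℤ)) := zpow_nonneg hε.1.le _
  rw [Real.norm_of_nonneg (hgSeminorm_nonneg _ _ _ _), Real.norm_of_nonneg hp]
  exact hgSeminorm_le (by positivity) (h ε hε)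

lemma HgNegligible.isConeSymb (hΩ : IsOpen Ω) {f : ℝ → Euc n × Euc p → ℝ}
    (hf : ∀ ε ∈ Ioc (0 : ℝ) 1, IsHomog Ω m (f ε)) (hb : HgNegligible Ω m f) :
    IsConeSymb NegligibleScale Ω m f := by
  refine isConeSymb_of_isHomog hΩ hf fun K hK hKc α β => ⟨_, ?_, fun _ _ => rfl⟩
  intro q
  obtain ⟨C, hC, η, hη, h⟩ := hb K hK hKc α β q
  refine IsBigO.of_bound C ?_
  filter_upwards [Ioc_mem_nhdsGT hη.1] with ε hε
  have hp : 0 ≤ ε ^ q := pow_nonneg hε.1.le _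
  rw [Real.norm_of_nonneg (hgSeminorm_nonneg _ _ _ _), Real.norm_of_nonneg hp]
  exact hgSeminorm_le (by positivity) (h ε hε)

lemma IsHomog.isConeSymb_const (hΩ : IsOpen Ω) {f : Euc n × Euc p → ℝ} (hf : IsHomog Ω m f) :
    IsConeSymb ModerateScale Ω m (fun _ => f) :=
  isConeSymb_of_isHomog hΩ (fun _ _ => hf) fun _ _ _ _ _ =>
    ⟨_, moderateScale_const _, fun _ _ => rfl⟩

lemma isHomog_inv_normSq : IsHomog Ω (-2) (fun z : Euc n × Euc p => (‖z.2‖ ^ 2)⁻¹) := by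
  refine ⟨(contDiff_snd.norm_sq ℝ).contDiffOn.inv fun z hz => ?_, fun y _ ξ _ t ht => ?_⟩
  · exact pow_ne_zero 2 (norm_ne_zero_iff.2 hz.2)
  · simp only [norm_smul, Real.norm_of_nonneg ht.le]
    rw [mul_pow, mul_inv, Real.rpow_neg ht.le]
    norm_num

/-! ### The cutoff as a symbol -/

lemma dirD_comp_snd {ψ : Euc p → ℝ} (hψ : ContDiff ℝ (⊤ : ℕ∞) ψ) (v : Euc n × Euc p) :
    dirD v (fun z : Euc n × Euc p => ψ z.2) = fun z => dirD v.2 ψ z.2 := by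
  funext z
  have h := (((hψ.differentiable (by simp)) z.2).hasFDerivAt.comp z
    (hasFDerivAt_snd (𝕜 := ℝ) (p := z))).fderiv
  simp only [dirD]
  erw [h]
  rfl

lemma contDiff_dirD {ψ : Euc p → ℝ} (hψ : ContDiff ℝ (⊤ : ℕ∞) ψ) (v : Euc p) :
    ContDiff ℝ (⊤ : ℕ∞) (dirD v ψ) :=
  contDiffOn_univ.1 (contDiffOn_dirD isOpen_univ hψ.contDiffOn v)

lemma dirD_eq_zero_of_const {ψ : Euc p → ℝ} {U : Set (Euc p)} (hU : IsOpen U) {c : ℝ}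
    (h : ∀ ξ ∈ U, ψ ξ = c) (v : Euc p) : ∀ ξ ∈ U, dirD v ψ ξ = 0 := by
  intro ξ hξ
  rw [dirD_eqOn hU (g := fun _ => c) h v hξ]
  simp [dirD]

lemma isConeSymb_of_annulus {ψ : Euc p → ℝ} (hψ : ContDiff ℝ (⊤ : ℕ∞) ψ)
    (h1 : ∀ ξ : Euc p, ‖ξ‖ < 1 / 4 → ψ ξ = 0) (h2 : ∀ ξ : Euc p, 1 / 2 < ‖ξ‖ → ψ ξ = 0) :
    IsConeSymb ModerateScale Ω m (fun (_ : ℝ) (z : Euc n × Euc p) => ψ z.2) := by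
  refine ⟨fun ε _ => (hψ.comp contDiff_snd).contDiffOn, fun k => ?_⟩
  have hB : ∀ (m : ℝ) (ψ : Euc p → ℝ), ContDiff ℝ (⊤ : ℕ∞) ψ →
      (∀ ξ : Euc p, ‖ξ‖ < 1 / 4 → ψ ξ = 0) → (∀ ξ : Euc p, 1 / 2 < ‖ξ‖ → ψ ξ = 0) →
      SymbBound ModerateScale Ω m (fun (_ : ℝ) (z : Euc n × Euc p) => ψ z.2) := by
    intro m ψ hψ h1 h2 K _ _
    have hc : IsCompact (Metric.closedBall (0 : Euc p) (1 / 2) ∩ {ξ | 1 / 4 ≤ ‖ξ‖}) :=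
      (isCompact_closedBall _ _).inter_right (isClosed_le continuous_const continuous_norm)
    obtain ⟨C, hC⟩ := hc.exists_bound_of_continuousOn (f := fun ξ => ‖ξ‖ ^ (-m) * ψ ξ) (by
      refine ContinuousOn.mul (continuous_norm.continuousOn.rpow_const fun ξ hξ => Or.inl ?_)
        hψ.continuous.continuousOn
      have : (1 : ℝ) / 4 ≤ ‖ξ‖ := hξ.2
      linarith)
    refine ⟨_, moderateScale_const C, fun ε _ y _ ξ hξ => ?_⟩
    have hpos : 0 < ‖ξ‖ := norm_pos_iff.2 hξ
    by_cases ha : ‖ξ‖ < 1 / 4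
    · simp only [h1 ξ ha, norm_zero]
      positivity
    by_cases hb : 1 / 2 < ‖ξ‖
    · simp only [h2 ξ hb, norm_zero]
      positivity
    have h := hC ξ ⟨by simpa using not_lt.1 hb, not_lt.1 ha⟩
    rw [norm_mul, Real.norm_of_nonneg (by positivity), Real.rpow_neg hpos.le,
      inv_mul_le_iff₀ (by positivity), mul_comm] at h
    exact h.trans (by gcongr; exact le_abs_self _)
  induction k generalizing m ψ with
  | zero => exact hB m ψ hψ h1 h2
  | succ k ih =>
    have hin : IsOpen {ξ : Euc p | ‖ξ‖ < 1 / 4} := isOpen_lt continuous_norm continuous_const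
    have hout : IsOpen {ξ : Euc p | 1 / 2 < ‖ξ‖} := isOpen_lt continuous_const continuous_norm
    refine ⟨hB m ψ hψ h1 h2, fun j => ?_, fun i => ?_⟩ <;>
    · simp only [dirD_comp_snd hψ]
      exact ih (contDiff_dirD hψ _) (dirD_eq_zero_of_const hin h1 _)
        (dirD_eq_zero_of_const hout h2 _)

lemma isConeSymb_one_sub_cutoff {χ : Euc p → ℝ} (hχ : IsCutoff χ) :
    IsConeSymb ModerateScale Ω 0 (fun (_ : ℝ) (z : Euc n × Euc p) => 1 - χ z.2) := by
  obtain ⟨hs, h1, h2⟩ := hχ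
  have hs' : ContDiff ℝ (⊤ : ℕ∞) (fun ξ => 1 - χ ξ) := contDiff_const.sub hs
  have hd : ∀ (m : ℝ) (v : Euc n × Euc p),
      IsConeSymb ModerateScale Ω m
        (fun _ : ℝ => dirD v (fun z : Euc n × Euc p => 1 - χ z.2)) := by
    intro m v
    simp only [dirD_comp_snd hs']
    refine isConeSymb_of_annulus (contDiff_dirD hs' _) ?_ ?_
    · exact dirD_eq_zero_of_const (isOpen_lt continuous_norm continuous_const)
        (c := 0) (fun ξ hξ => by rw [h1 ξ hξ, sub_self]) _
    · exact dirD_eq_zero_of_const (isOpen_lt continuous_const continuous_norm)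
        (c := 1) (fun ξ hξ => by rw [h2 ξ hξ, sub_zero]) _
  refine .of_deriv (fun ε _ => (hs'.comp contDiff_snd).contDiffOn) (fun K _ _ => ?_)
    (fun j => hd _ _) fun i => hd _ _
  obtain ⟨C, hC⟩ := (isCompact_closedBall (0 : Euc p) (1 / 2)).exists_bound_of_continuousOn
    hs'.continuous.continuousOn
  refine ⟨_, moderateScale_const (max C 1), fun ε _ y _ ξ _ => ?_⟩
  rw [Real.rpow_zero, mul_one]
  refine le_trans ?_ (le_abs_self _)
  by_cases hb : 1 / 2 < ‖ξ‖
  · simp [h2 ξ hb]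
  · exact (hC ξ (by simpa using not_lt.1 hb)).trans (le_max_left _ _)

/-! ### Equivalent moderate nets of symbols -/

/-- Moderate nets of symbols of order `m` whose difference is negligible. -/
structure SymbEquiv (Ω : Set (Euc n)) (m : ℝ) (f g : ℝ → Euc n × Euc p → ℝ) : Prop where
  left : IsConeSymb ModerateScale Ω m f
  right : IsConeSymb ModerateScale Ω m g
  sub : IsConeSymb NegligibleScale Ω m (fun ε z => f ε z - g ε z)

lemma negligibleScale_zero : NegligibleScale (fun _ => 0) := fun _ => isBigO_zero _ _

namespace SymbEquiv

variable {f g f' g' : ℝ → Euc n × Euc p → ℝ}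

lemma refl (hf : IsConeSymb ModerateScale Ω m f) : SymbEquiv Ω m f f :=
  ⟨hf, hf, by simpa only [sub_self] using IsConeSymb.zero negligibleScale_zero⟩

lemma congr (hΩ : IsOpen Ω) (h : SymbEquiv Ω m f g)
    (hf : ∀ ε ∈ Ioc (0 : ℝ) 1, EqOn (f' ε) (f ε) (coneDom p Ω))
    (hg : ∀ ε ∈ Ioc (0 : ℝ) 1, EqOn (g' ε) (g ε) (coneDom p Ω)) : SymbEquiv Ω m f' g' :=
  ⟨h.left.congr hΩ hf, h.right.congr hΩ hg, h.sub.congr hΩ fun ε hε z hz => by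
    simp only [hf ε hε hz, hg ε hε hz]⟩

lemma add (hΩ : IsOpen Ω) (h : SymbEquiv Ω m f g) (h' : SymbEquiv Ω m f' g') :
    SymbEquiv Ω m (fun ε z => f ε z + f' ε z) (fun ε z => g ε z + g' ε z) :=
  ⟨h.left.add hΩ isGrowthScale_moderate h'.left, h.right.add hΩ isGrowthScale_moderate h'.right,
    (h.sub.add hΩ isGrowthScale_negligible h'.sub).congr hΩ fun ε _ z _ => by ring⟩

lemma mul (hΩ : IsOpen Ω) (h : SymbEquiv Ω m f g) (h' : SymbEquiv Ω m' f' g') :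
    SymbEquiv Ω (m + m') (fun ε z => f ε z * f' ε z) (fun ε z => g ε z * g' ε z) := by
  refine ⟨h.left.mul hΩ isGrowthScale_moderate h'.left,
    h.right.mul hΩ isGrowthScale_moderate h'.right, ?_⟩
  have h1 := h.left.mul hΩ isGrowthScale_negligible h'.sub
  have h2 := h'.right.mul hΩ isGrowthScale_negligible h.sub
  rw [add_comm] at h2
  exact (h1.add hΩ isGrowthScale_negligible h2).congr hΩ fun ε _ z _ => by ring

lemma sum (hΩ : IsOpen Ω) {ι : Type*} (s : Finset ι) {f g : ι → ℝ → Euc n × Euc p → ℝ}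
    (h : ∀ i, SymbEquiv Ω m (f i) (g i)) :
    SymbEquiv Ω m (fun ε z => ∑ i ∈ s, f i ε z) (fun ε z => ∑ i ∈ s, g i ε z) := by
  refine ⟨.sum hΩ isGrowthScale_moderate (moderateScale_const 0) s fun i => (h i).left,
    .sum hΩ isGrowthScale_moderate (moderateScale_const 0) s fun i => (h i).right, ?_⟩
  simp only [← Finset.sum_sub_distrib]
  exact .sum hΩ isGrowthScale_negligible negligibleScale_zero s fun i => (h i).sub

lemma inv (hΩ : IsOpen Ω) (h : SymbEquiv Ω m f g)
    (hf : ∀ ε ∈ Ioc (0 : ℝ) 1, ∀ z ∈ coneDom p Ω, f ε z ≠ 0)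
    (hg : ∀ ε ∈ Ioc (0 : ℝ) 1, ∀ z ∈ coneDom p Ω, g ε z ≠ 0)
    (hfb : SymbBound ModerateScale Ω (-m) (fun ε z => (f ε z)⁻¹))
    (hgb : SymbBound ModerateScale Ω (-m) (fun ε z => (g ε z)⁻¹)) :
    SymbEquiv Ω (-m) (fun ε z => (f ε z)⁻¹) (fun ε z => (g ε z)⁻¹) := by
  have hfi := h.left.inv hΩ hf hfb
  have hgi := h.right.inv hΩ hg hgb
  refine ⟨hfi, hgi, ?_⟩
  have h1 := (IsConeSymb.const (Ω := Ω) (n := n) (p := p) (-1 : ℝ)).mul hΩ isGrowthScale_negligible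
    ((hfi.mul hΩ isGrowthScale_moderate hgi).mul hΩ isGrowthScale_negligible h.sub)
  rw [show 0 + (-m + -m + m) = -m by ring] at h1
  refine h1.congr hΩ fun ε hε z hz => ?_
  have := hf ε hε z hz
  have := hg ε hε z hz
  field_simp
  ring

lemma dirD_eXi (hΩ : IsOpen Ω) (h : SymbEquiv Ω m f g) (j : Fin p) :
    SymbEquiv Ω (m - 1) (fun ε => dirD (eXi j) (f ε)) (fun ε => dirD (eXi j) (g ε)) :=
  ⟨h.left.dirD_eXi hΩ j, h.right.dirD_eXi hΩ j, (h.sub.dirD_eXi hΩ j).congr hΩ fun ε hε =>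
    (dirD_sub (isOpen_coneDom hΩ) (h.left.smooth ε hε) (h.right.smooth ε hε) _).symm⟩

lemma dirD_eY (hΩ : IsOpen Ω) (h : SymbEquiv Ω m f g) (i : Fin n) :
    SymbEquiv Ω m (fun ε => dirD (eY i) (f ε)) (fun ε => dirD (eY i) (g ε)) :=
  ⟨h.left.dirD_eY hΩ i, h.right.dirD_eY hΩ i, (h.sub.dirD_eY hΩ i).congr hΩ fun ε hε =>
    (dirD_sub (isOpen_coneDom hΩ) (h.left.smooth ε hε) (h.right.smooth ε hε) _).symm⟩

end SymbEquiv

/-! ### From the cone to `Ω × ℝ^p` -/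

lemma contDiffOn_of_cone (hΩ : IsOpen Ω) {f : Euc n × Euc p → F}
    (hf : ContDiffOn ℝ (⊤ : ℕ∞) f (coneDom p Ω))
    (h0 : ∀ y ∈ Ω, ∀ ξ : Euc p, ‖ξ‖ < 1 / 4 → f (y, ξ) = 0) :
    ContDiffOn ℝ (⊤ : ℕ∞) f (Ω ×ˢ (univ : Set (Euc p))) := by
  rintro ⟨y, ξ⟩ ⟨hy, -⟩
  apply ContDiffAt.contDiffWithinAt
  by_cases hξ : ξ = 0
  · have hU : IsOpen (Ω ×ˢ {ξ : Euc p | ‖ξ‖ < 1 / 4}) :=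
      hΩ.prod (isOpen_lt continuous_norm continuous_const)
    have he : f =ᶠ[𝓝 (y, ξ)] fun _ => 0 :=
      eventuallyEq_of_mem (hU.mem_nhds ⟨hy, by simp [hξ]⟩) fun z hz => h0 z.1 hz.1 z.2 hz.2
    exact contDiffAt_const.congr_of_eventuallyEq he
  · exact hf.contDiffAt ((isOpen_coneDom hΩ).mem_nhds ⟨hy, hξ⟩)

lemma jb_rpow_le (s : ℝ) {ξ : Euc p} (hξ : 1 / 4 ≤ ‖ξ‖) : jb ξ ^ s ≤ 5 ^ |s| * ‖ξ‖ ^ s := by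
  have hpos : 0 < ‖ξ‖ := by linarith
  have hle : ‖ξ‖ ≤ jb ξ := Real.le_sqrt_of_sq_le (by linarith)
  have hle' : jb ξ ≤ 5 * ‖ξ‖ := Real.sqrt_le_iff.2 ⟨by positivity, by nlinarith⟩
  rcases le_total 0 s with hs | hs
  · rw [abs_of_nonneg hs, ← Real.mul_rpow (by norm_num) hpos.le]
    exact Real.rpow_le_rpow (hpos.le.trans hle) hle' hs
  · refine (Real.rpow_le_rpow_of_nonpos hpos hle hs).trans ?_
    exact le_mul_of_one_le_left (by positivity)
      (Real.one_le_rpow (by norm_num) (abs_nonneg s))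

lemma IsConeSymb.symbNegligible (hΩ : IsOpen Ω) {f : ℝ → Euc n × Euc p → ℂ}
    (hf : IsConeSymb NegligibleScale Ω m f)
    (h0 : ∀ ε ∈ Ioc (0 : ℝ) 1, ∀ y ∈ Ω, ∀ ξ : Euc p, ‖ξ‖ < 1 / 4 → f ε (y, ξ) = 0) :
    SymbNegligible Ω m 1 0 f := by
  have key : ∀ K ⊆ Ω, IsCompact K → ∀ (α : List (Fin p)) (β : List (Fin n)),
      ∃ g : ℝ → ℝ, NegligibleScale g ∧ ∀ ε ∈ Ioc (0 : ℝ) 1, ∀ y ∈ K, ∀ ξ : Euc p,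
      jb ξ ^ (-m + 1 * (α.length : ℝ) - 0 * (β.length : ℝ)) *
        ‖_root_.dirDs (α.map eXi ++ β.map eY) (f ε) (y, ξ)‖ ≤ |g ε| := by
    intro K hK hKc α β
    obtain ⟨g, hg, hgε⟩ := ((hf.dirDs hΩ α β).bound 0) K hK hKc
    rw [one_mul, zero_mul, sub_zero]
    set s : ℝ := -m + α.length with hs
    refine ⟨_, isGrowthScale_negligible.mul _ g (moderateScale_const (5 ^ |s|)) hg,
      fun ε hε y hy ξ => ?_⟩
    by_cases hξ : ‖ξ‖ < 1 / 4
    · have hU : IsOpen (Ω ×ˢ {ξ : Euc p | ‖ξ‖ < 1 / 4}) :=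
        hΩ.prod (isOpen_lt continuous_norm continuous_const)
      have hz := dirDs_eqOn hU (f := f ε) (g := fun _ => 0)
        (fun z hz => h0 ε hε z.1 hz.1 z.2 hz.2) (α.map eXi ++ β.map eY)
        (show (y, ξ) ∈ Ω ×ˢ {ξ : Euc p | ‖ξ‖ < 1 / 4} from ⟨hK hy, hξ⟩)
      rw [hz, dirDs_zero, norm_zero, mul_zero]
      positivity
    · have hξ' := not_lt.1 hξ
      have hpos : 0 < ‖ξ‖ := by linarith
      have hb := hgε ε hε y hy ξ (norm_pos_iff.1 hpos)
      rw [show m - α.length = -s by rw [hs]; ring] at hb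
      calc _ ≤ (5 ^ |s| * ‖ξ‖ ^ s) * (|g ε| * ‖ξ‖ ^ (-s)) :=
            mul_le_mul (jb_rpow_le s hξ') hb (norm_nonneg _) (by positivity)
        _ = 5 ^ |s| * |g ε| * (‖ξ‖ ^ s * ‖ξ‖ ^ (-s)) := by ring
        _ = |5 ^ |s| * g ε| := by
          rw [← Real.rpow_add hpos, add_neg_cancel, Real.rpow_zero, mul_one, abs_mul,
            abs_of_nonneg (a := (5 : ℝ) ^ |s|) (by positivity)]
  refine ⟨fun ε hε => contDiffOn_of_cone hΩ (hf.smooth ε hε) (h0 ε hε), ?_, ?_⟩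
  · intro ε hε K hK hKc α β
    obtain ⟨g, -, h⟩ := key K hK hKc α β
    exact ⟨_, h ε hε⟩
  · intro K hK hKc α β q
    obtain ⟨g, hg, h⟩ := key K hK hKc α β
    obtain ⟨C, hC, hgC⟩ := (hg q).exists_pos
    obtain ⟨u, hu, hsub⟩ := mem_nhdsGT_iff_exists_Ioc_subset.1 hgC.bound
    refine ⟨C, hC, min u 1, ⟨lt_min hu one_pos, min_le_right _ _⟩, fun ε hε y hy ξ => ?_⟩
    have h1 := hsub ⟨hε.1, hε.2.trans (min_le_left _ _)⟩
    refine (h ε ⟨hε.1, hε.2.trans (min_le_right _ _)⟩ y hy ξ).trans ?_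
    have hp : 0 ≤ ε ^ q := pow_nonneg hε.1.le _
    simpa [abs_of_nonneg hp, abs_of_pos hε.1] using h1

/-! ### Phase functions -/

lemma IsPhaseNet.isHomog {φ : ℝ → Euc n × Euc p → ℝ} (hφ : IsPhaseNet Ω φ) {ε : ℝ}
    (hε : ε ∈ Ioc (0 : ℝ) 1) : IsHomog Ω 1 (φ ε) :=
  ⟨(hφ ε hε).1, fun y hy ξ hξ t ht => by rw [Real.rpow_one, (hφ ε hε).2.1 y hy ξ hξ t ht]⟩

lemma IsHomog.sub {f g : Euc n × Euc p → ℝ} (hf : IsHomog Ω m f) (hg : IsHomog Ω m g) :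
    IsHomog Ω m (fun z => f z - g z) :=
  ⟨hf.smooth.sub hg.smooth, fun y hy ξ hξ t ht => by
    rw [hf.hom y hy ξ hξ t ht, hg.hom y hy ξ hξ t ht, mul_sub]⟩

lemma gradSq_normalize (hΩ : IsOpen Ω) {φ : Euc n × Euc p → ℝ} (hφ : IsHomog Ω 1 φ)
    {z : Euc n × Euc p} (hz : z ∈ coneDom p Ω) :
    gradSq φ (z.1, ‖z.2‖⁻¹ • z.2) =
      (∑ i : Fin n, (‖z.2‖ ^ 2)⁻¹ * (dirD (eY i) φ z * dirD (eY i) φ z)) +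
        ∑ j : Fin p, dirD (eXi j) φ z * dirD (eXi j) φ z := by
  have hpos : 0 < ‖z.2‖⁻¹ := inv_pos.2 (norm_pos_iff.2 hz.2)
  simp only [gradSq]
  congr 1
  · refine Finset.sum_congr rfl fun i _ => ?_
    rw [(hφ.dirD_eY hΩ i).hom z.1 hz.1 z.2 hz.2 _ hpos, Real.rpow_one]
    simp only [Prod.mk.eta]
    ring
  · refine Finset.sum_congr rfl fun j _ => ?_
    rw [(hφ.dirD_eXi hΩ j).hom z.1 hz.1 z.2 hz.2 _ hpos, sub_self, Real.rpow_zero]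
    simp only [Prod.mk.eta]
    ring

lemma gradSq_normalize_ne_zero {φ : ℝ → Euc n × Euc p → ℝ} (hφ : IsPhaseNet Ω φ) {ε : ℝ}
    (hε : ε ∈ Ioc (0 : ℝ) 1) {z : Euc n × Euc p} (hz : z ∈ coneDom p Ω) :
    gradSq (φ ε) (z.1, ‖z.2‖⁻¹ • z.2) ≠ 0 :=
  (hφ ε hε).2.2 z.1 hz.1 _ (smul_ne_zero (inv_ne_zero (norm_ne_zero_iff.2 hz.2)) hz.2)

lemma isHomog_varphiN (hΩ : IsOpen Ω) {φ : ℝ → Euc n × Euc p → ℝ} (hφ : IsPhaseNet Ω φ) {ε : ℝ}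
    (hε : ε ∈ Ioc (0 : ℝ) 1) : IsHomog Ω 0 (varphiN (φ ε)) := by
  have hh := hφ.isHomog hε
  refine ⟨ContDiffOn.inv ?_ fun z hz => gradSq_normalize_ne_zero hφ hε hz,
    fun y _ ξ hξ t ht => ?_⟩
  · refine ContDiffOn.congr ?_ fun z hz => gradSq_normalize hΩ hh hz
    exact (ContDiffOn.sum fun i _ => isHomog_inv_normSq.smooth.mul
      ((hh.dirD_eY hΩ i).smooth.mul (hh.dirD_eY hΩ i).smooth)).add
      (ContDiffOn.sum fun j _ => (hh.dirD_eXi hΩ j).smooth.mul (hh.dirD_eXi hΩ j).smooth)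
  · have h : ‖t • ξ‖⁻¹ • t • ξ = ‖ξ‖⁻¹ • ξ := by
      rw [norm_smul, Real.norm_of_nonneg ht.le, smul_smul]
      congr 1
      field_simp
    simp only [varphiN, h, Real.rpow_zero, one_mul]

lemma symbBound_varphiN (hΩ : IsOpen Ω) {φ : ℝ → Euc n × Euc p → ℝ} (hφ : MPhi Ω φ) :
    SymbBound ModerateScale Ω 0 (fun ε => varphiN (φ ε)) := by
  refine symbBound_of_isHomog (fun ε hε => isHomog_varphiN hΩ hφ.1 hε)
    fun K hK hKc => ⟨_, ?_, fun _ _ => rfl⟩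
  obtain ⟨r, hr, η, hη, h⟩ := hφ.2.2 K hK hKc
  refine ⟨⌈r⌉₊, IsBigO.of_bound 1 ?_⟩
  filter_upwards [Ioc_mem_nhdsGT hη.1] with ε hε
  have hp : 0 ≤ ε ^ (-(⌈r⌉₊ : ℤ)) := zpow_nonneg hε.1.le _
  rw [Real.norm_of_nonneg (hgSeminorm_nonneg _ _ _ _), Real.norm_of_nonneg hp, one_mul]
  refine hgSeminorm_le hp fun y hy ξ hξ => ?_
  have hlow := h ε hε y hy ξ hξ
  have hεr : 0 < ε ^ r := Real.rpow_pos_of_pos hε.1 r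
  have hceil : ε ^ ⌈r⌉₊ ≤ ε ^ r := by
    rw [← Real.rpow_natCast]
    exact Real.rpow_le_rpow_of_exponent_ge hε.1 (hε.2.trans hη.2) (Nat.le_ceil r)
  simp only [List.length_nil, Nat.cast_zero, neg_zero, add_zero, Real.rpow_zero, one_mul,
    List.map_nil, List.append_nil, dirDs, List.foldr_nil, varphiN, zpow_neg, zpow_natCast]
  rw [Real.norm_of_nonneg (inv_nonneg.2 (hεr.le.trans hlow))]
  exact inv_anti₀ (pow_pos hε.1 _) (hceil.trans hlow)

section Equivalence

variable {φ ω : ℝ → Euc n × Euc p → ℝ}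

lemma symbEquiv_phase (hΩ : IsOpen Ω) (hφ : MPhi Ω φ) (hω : MPhi Ω ω)
    (hdiff : HgNegligible Ω 1 (fun ε z => φ ε z - ω ε z)) : SymbEquiv Ω 1 φ ω :=
  ⟨hφ.2.1.isConeSymb hΩ fun _ hε => hφ.1.isHomog hε,
    hω.2.1.isConeSymb hΩ fun _ hε => hω.1.isHomog hε,
    hdiff.isConeSymb hΩ fun _ hε => (hφ.1.isHomog hε).sub (hω.1.isHomog hε)⟩

lemma symbEquiv_varphiN (hΩ : IsOpen Ω) (hφ : MPhi Ω φ) (hω : MPhi Ω ω)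
    (hdiff : HgNegligible Ω 1 (fun ε z => φ ε z - ω ε z)) :
    SymbEquiv Ω 0 (fun ε => varphiN (φ ε)) (fun ε => varphiN (ω ε)) := by
  have h := symbEquiv_phase hΩ hφ hω hdiff
  have hr : SymbEquiv Ω (-2) (fun (_ : ℝ) (z : Euc n × Euc p) => (‖z.2‖ ^ 2)⁻¹)
      (fun _ z => (‖z.2‖ ^ 2)⁻¹) := .refl (isHomog_inv_normSq.isConeSymb_const hΩ)
  have hY := SymbEquiv.sum hΩ Finset.univ fun i : Fin n =>
    hr.mul hΩ ((h.dirD_eY hΩ i).mul hΩ (h.dirD_eY hΩ i))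
  have hX := SymbEquiv.sum hΩ Finset.univ fun j : Fin p =>
    (h.dirD_eXi hΩ j).mul hΩ (h.dirD_eXi hΩ j)
  norm_num at hY hX
  have hN := (hY.add hΩ hX).congr hΩ
    (fun _ hε _ hz => gradSq_normalize hΩ (hφ.1.isHomog hε) hz)
    (fun _ hε _ hz => gradSq_normalize hΩ (hω.1.isHomog hε) hz)
  have hI := hN.inv hΩ (fun _ hε _ hz => gradSq_normalize_ne_zero hφ.1 hε hz)
    (fun _ hε _ hz => gradSq_normalize_ne_zero hω.1 hε hz)
    (by rw [neg_zero]; exact symbBound_varphiN hΩ hφ)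
    (by rw [neg_zero]; exact symbBound_varphiN hΩ hω)
  rw [neg_zero] at hI
  exact hI

/-- Multiplication by `i` as a real-linear map from `ℝ` to `ℂ`. -/
def mulI : ℝ →L[ℝ] ℂ := Complex.I • Complex.ofRealCLM

lemma mulI_apply (x : ℝ) : mulI x = Complex.I * (x : ℂ) := rfl

variable {χ : Euc p → ℝ}

lemma isConeSymb_coefA_sub (hΩ : IsOpen Ω) (hφ : MPhi Ω φ) (hω : MPhi Ω ω)
    (hdiff : HgNegligible Ω 1 (fun ε z => φ ε z - ω ε z)) (hχ : IsCutoff χ) (j : Fin p) :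
    (SmoothNet Ω fun ε => coefA χ (φ ε) j) ∧ (SmoothNet Ω fun ε => coefA χ (ω ε) j) ∧
      IsConeSymb NegligibleScale Ω 0 (fun ε z => coefA χ (φ ε) j z - coefA χ (ω ε) j z) := by
  have hc : SymbEquiv Ω 0 (fun (_ : ℝ) (z : Euc n × Euc p) => 1 - χ z.2) (fun _ z => 1 - χ z.2) :=
    .refl (isConeSymb_one_sub_cutoff hχ)
  have h := (hc.mul hΩ (symbEquiv_varphiN hΩ hφ hω hdiff)).mul hΩ
    ((symbEquiv_phase hΩ hφ hω hdiff).dirD_eXi hΩ j)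
  norm_num at h
  refine ⟨(h.left.clm_comp hΩ isGrowthScale_moderate mulI).smooth,
    (h.right.clm_comp hΩ isGrowthScale_moderate mulI).smooth,
    (h.sub.clm_comp hΩ isGrowthScale_negligible mulI).congr hΩ fun ε _ z _ => ?_⟩
  simp only [map_sub, mulI_apply, coefA]

lemma isConeSymb_coefB_sub (hΩ : IsOpen Ω) (hφ : MPhi Ω φ) (hω : MPhi Ω ω)
    (hdiff : HgNegligible Ω 1 (fun ε z => φ ε z - ω ε z)) (hχ : IsCutoff χ) (i : Fin n) :
    (SmoothNet Ω fun ε => coefB χ (φ ε) i) ∧ (SmoothNet Ω fun ε => coefB χ (ω ε) i) ∧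
      IsConeSymb NegligibleScale Ω (-1) (fun ε z => coefB χ (φ ε) i z - coefB χ (ω ε) i z) := by
  have hc : SymbEquiv Ω 0 (fun (_ : ℝ) (z : Euc n × Euc p) => 1 - χ z.2) (fun _ z => 1 - χ z.2) :=
    .refl (isConeSymb_one_sub_cutoff hχ)
  have hr : SymbEquiv Ω (-2) (fun (_ : ℝ) (z : Euc n × Euc p) => (‖z.2‖ ^ 2)⁻¹)
      (fun _ z => (‖z.2‖ ^ 2)⁻¹) := .refl (isHomog_inv_normSq.isConeSymb_const hΩ)
  have h := ((hc.mul hΩ hr).mul hΩ (symbEquiv_varphiN hΩ hφ hω hdiff)).mul hΩ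
    ((symbEquiv_phase hΩ hφ hω hdiff).dirD_eY hΩ i)
  norm_num at h
  refine ⟨(h.left.clm_comp hΩ isGrowthScale_moderate mulI).smooth,
    (h.right.clm_comp hΩ isGrowthScale_moderate mulI).smooth,
    (h.sub.clm_comp hΩ isGrowthScale_negligible mulI).congr hΩ fun ε _ z _ => ?_⟩
  simp only [map_sub, mulI_apply, coefB]

lemma isConeSymb_coefC_sub (hΩ : IsOpen Ω) (hφ : MPhi Ω φ) (hω : MPhi Ω ω)
    (hdiff : HgNegligible Ω 1 (fun ε z => φ ε z - ω ε z)) (hχ : IsCutoff χ) :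
    IsConeSymb NegligibleScale Ω (-1) (fun ε z => coefC χ (φ ε) z - coefC χ (ω ε) z) := by
  have hA := isConeSymb_coefA_sub hΩ hφ hω hdiff hχ
  have hB := isConeSymb_coefB_sub hΩ hφ hω hdiff hχ
  have h1 := IsConeSymb.sum hΩ isGrowthScale_negligible negligibleScale_zero Finset.univ
    fun j => (hA j).2.2.dirD_eXi hΩ j
  rw [zero_sub] at h1
  have h2 := IsConeSymb.sum hΩ isGrowthScale_negligible negligibleScale_zero Finset.univ
    fun i => (hB i).2.2.dirD_eY hΩ i
  refine (h1.add hΩ isGrowthScale_negligible h2).congr hΩ fun ε hε z hz => ?_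
  have hU := isOpen_coneDom (p := p) hΩ
  have e1 : ∀ j, dirD (eXi j) (fun z => coefA χ (φ ε) j z - coefA χ (ω ε) j z) z =
      dirD (eXi j) (coefA χ (φ ε) j) z - dirD (eXi j) (coefA χ (ω ε) j) z := fun j =>
    dirD_sub hU ((hA j).1 ε hε) ((hA j).2.1 ε hε) _ hz
  have e2 : ∀ i, dirD (eY i) (fun z => coefB χ (φ ε) i z - coefB χ (ω ε) i z) z =
      dirD (eY i) (coefB χ (φ ε) i) z - dirD (eY i) (coefB χ (ω ε) i) z := fun i =>
    dirD_sub hU ((hB i).1 ε hε) ((hB i).2.1 ε hε) _ hz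
  simp only [e1, e2, Finset.sum_sub_distrib]
  simp only [coefC]
  ring

lemma coefA_eq_zero (hχ : IsCutoff χ) (f : Euc n × Euc p → ℝ) (j : Fin p) (z : Euc n × Euc p)
    (hz : ‖z.2‖ < 1 / 4) : coefA χ f j z = 0 := by
  simp [coefA, hχ.2.1 z.2 hz]

lemma coefB_eq_zero (hχ : IsCutoff χ) (f : Euc n × Euc p → ℝ) (i : Fin n) (z : Euc n × Euc p)
    (hz : ‖z.2‖ < 1 / 4) : coefB χ f i z = 0 := by
  simp [coefB, hχ.2.1 z.2 hz]

lemma coefC_eq_one (hχ : IsCutoff χ) (f : Euc n × Euc p → ℝ) (z : Euc n × Euc p)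
    (hz : ‖z.2‖ < 1 / 4) : coefC χ f z = 1 := by
  have hU : IsOpen {z : Euc n × Euc p | ‖z.2‖ < 1 / 4} :=
    isOpen_lt continuous_snd.norm continuous_const
  have hd : ∀ g : Euc n × Euc p → ℂ, (∀ z, ‖z.2‖ < 1 / 4 → g z = 0) → ∀ v, dirD v g z = 0 := by
    intro g hg v
    rw [dirD_eqOn hU (g := fun _ => 0) hg v hz]
    simp [dirD]
  simp [coefC, hd _ (coefA_eq_zero hχ f _), hd _ (coefB_eq_zero hχ f _), hχ.2.1 z.2 hz]

end Equivalence

end Symbols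

/-- Proposition comparing L_φ and L_ω: if (φ_ε) ∼ (ω_ε) in M_Φ(Ω×ℝ^p),
the differences of the coefficients of L_{φ_ε} and L_{ω_ε} are negligible nets in
S^0(Ω×ℝ^p) resp. S^{-1}(Ω×ℝ^p). -/
theorem stmt5 {n p : ℕ} (Ω : Set (Euc n)) (hΩ : IsOpen Ω)
    (φ ω : ℝ → Euc n × Euc p → ℝ) (hφ : MPhi Ω φ) (hω : MPhi Ω ω)
    (hdiff : HgNegligible Ω 1 (fun ε z => φ ε z - ω ε z))
    (χ : Euc p → ℝ) (hχ : IsCutoff χ) :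
    (∀ j : Fin p, SymbNegligible Ω 0 1 0
      (fun ε z => coefA χ (φ ε) j z - coefA χ (ω ε) j z)) ∧
    (∀ k : Fin n, SymbNegligible Ω (-1) 1 0
      (fun ε z => coefB χ (φ ε) k z - coefB χ (ω ε) k z)) ∧
    SymbNegligible Ω (-1) 1 0 (fun ε z => coefC χ (φ ε) z - coefC χ (ω ε) z) := by
  refine ⟨fun j => ?_, fun k => ?_, ?_⟩
  · refine (isConeSymb_coefA_sub hΩ hφ hω hdiff hχ j).2.2.symbNegligible hΩ
      fun ε _ y _ ξ hξ => ?_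
    rw [coefA_eq_zero hχ _ _ (y, ξ) hξ, coefA_eq_zero hχ _ _ (y, ξ) hξ, sub_self]
  · refine (isConeSymb_coefB_sub hΩ hφ hω hdiff hχ k).2.2.symbNegligible hΩ
      fun ε _ y _ ξ hξ => ?_
    rw [coefB_eq_zero hχ _ _ (y, ξ) hξ, coefB_eq_zero hχ _ _ (y, ξ) hξ, sub_self]
  · refine (isConeSymb_coefC_sub hΩ hφ hω hdiff hχ).symbNegligible hΩ fun ε _ y _ ξ hξ => ?_
    rw [coefC_eq_one hχ _ (y, ξ) hξ, coefC_eq_one hχ _ (y, ξ) hξ, sub_self]
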